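/- arXiv:0907.0958 — 3 statements merged into one kernel-verified Lean document; each statement's English description precedes it below -/
import Mathlib

section
/- Let L ⊂ ℝ^N be a lattice of rank r ≤ N, let V ⊆ ℝ^N be the r-dimensional subspace spanned by L, and let W = V + w be an affine subspace parallel to V (for some w ∈ ℝ^N). Let K ⊂ ℝ^N be a compact convex set with non-empty interior K°, let φ : K → ℝ be continuous such that the restriction of φ to K ∩ W has a unique maximum at a point x₀ ∈ K° ∩ W, suppose φ is twice continuously differentiable in a neighbourhood of x₀ with Hessian H = D²φ(x₀), and let ψ : K₁ → ℝ be continuous on a neighbourhood K₁ ⊆ K of x₀ with ψ(x₀) > 0. Suppose that for each positive integer n there are a vector ℓ_n ∈ ℝ^N with ℓ_n/n ∈ W, a positive real b_n, and a function a_n : (L + ℓ_n) ∩ nK → ℝ such that, uniformly as n → ∞: a_n(ℓ) = O(b_n e^{nφ(ℓ/n) + o(n)}) for ℓ ∈ (L + ℓ_n) ∩ nK, and a_n(ℓ) = b_n (ψ(ℓ/n) + o(1)) e^{nφ(ℓ/n)} for ℓ ∈ (L + ℓ_n) ∩ nK₁. Then, provided det(−H|_V) ≠ 0, as n → ∞,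 Σ_{ℓ ∈ (L+ℓ_n) ∩ nK} a_n(ℓ) ∼ (2π)^{r/2} ψ(x₀) b_n n^{r/2} e^{nφ(x₀)} / (Vol(L) · det(−H|_V)^{1/2}). -/
open MeasureTheory Filter Topology Asymptotics

theorem ContDiffAt.isLittleO_taylor_two {E : Type*} [NormedAddCommGroup E] [NormedSpace ℝ E]
    {f : E → ℝ} {x : E} (hf : ContDiffAt ℝ 2 f x) :
    (fun h : E => f (x + h) - f x - fderiv ℝ f x h - (1 / 2) * fderiv ℝ (fderiv ℝ f) x h h)
      =o[𝓝 0] fun h => ‖h‖ ^ 2 := by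
  have hsymm : IsSymmSndFDerivAt ℝ f x := hf.isSymmSndFDerivAt (by simp)
  have hdd : HasFDerivAt (fderiv ℝ f) (fderiv ℝ (fderiv ℝ f) x) x :=
    ((hf.fderiv_right (m := 1) (by norm_num)).differentiableAt (by norm_num)).hasFDerivAt
  set D := fderiv ℝ (fderiv ℝ f) x with hD
  have hev : ∀ᶠ y in 𝓝 x, DifferentiableAt ℝ f y :=
    (hf.eventually (by simp)).mono fun y hy => hy.differentiableAt (by norm_num)
  have hshift : Tendsto (fun h : E => x + h) (𝓝 0) (𝓝 x) := by
    exact Continuous.tendsto' (by fun_prop) _ _ (add_zero x)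
  rw [isLittleO_iff]
  intro c hc
  have h1 : ∀ᶠ h : E in 𝓝 0,
      ‖fderiv ℝ f (x + h) - fderiv ℝ f x - D h‖ ≤ c * ‖h‖ :=
    (isLittleO_iff.1 (hasFDerivAt_iff_isLittleO_nhds_zero.1 hdd)) hc
  obtain ⟨ρ, hρ, hball⟩ := Metric.eventually_nhds_iff_ball.1 (h1.and (hshift.eventually hev))
  filter_upwards [Metric.ball_mem_nhds (0 : E) hρ] with h hh
  have hder : ∀ y ∈ Metric.closedBall (0 : E) ‖h‖, HasFDerivWithinAt
      (fun h : E => f (x + h) - f x - fderiv ℝ f x h - (1 / 2) * D h h)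
      (fderiv ℝ f (x + y) - fderiv ℝ f x - D y) (Metric.closedBall (0 : E) ‖h‖) y := by
    intro y hy
    have hyρ : y ∈ Metric.ball (0 : E) ρ := by
      simp only [Metric.mem_closedBall, Metric.mem_ball, dist_zero_right] at hy hh ⊢
      exact hy.trans_lt hh
    have e1 : HasFDerivAt (fun h : E => f (x + h)) (fderiv ℝ f (x + y)) y :=
      (hasFDerivAt_comp_add_left x).2 (hball y hyρ).2.hasFDerivAt
    have e2 : HasFDerivAt (fun h : E => D h h) (D y + D.flip y) y := by
      refine (D.hasFDerivAt.clm_apply (hasFDerivAt_id y)).congr_fderiv ?_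
      ext v
      simp
    refine ((((e1.sub_const (f x)).sub (fderiv ℝ f x).hasFDerivAt).sub
      (e2.const_mul (1 / 2))).congr_fderiv ?_).hasFDerivWithinAt
    ext v
    have := hsymm.eq v y
    simp only [sub_apply, smul_apply,
      add_apply, ContinuousLinearMap.flip_apply, smul_eq_mul]
    rw [← hD] at this
    rw [this]
    ring
  have hmv := (convex_closedBall (0 : E) ‖h‖).norm_image_sub_le_of_norm_hasFDerivWithin_le
    (C := c * ‖h‖) hder (fun y hy => ?_) (x := 0) (y := h) (by simp) (by simp)
  · simp only [add_zero, sub_self, map_zero, mul_zero, sub_zero] at hmv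
    simpa [pow_two, mul_assoc] using hmv
  · have hy' : ‖y‖ ≤ ‖h‖ := by simpa using hy
    have hyρ : y ∈ Metric.ball (0 : E) ρ := by
      simp only [Metric.mem_ball, dist_zero_right] at hh ⊢
      exact hy'.trans_lt hh
    exact (hball y hyρ).1.trans (by gcongr)

theorem integral_exp_neg_half_quadratic {ι : Type*} [Fintype ι] [DecidableEq ι]
    {A : Matrix ι ι ℝ} (hA : A.PosDef) :
    ∫ y : ι → ℝ, Real.exp (-(1 / 2) * (y ⬝ᵥ A.mulVec y)) =
      (2 * Real.pi) ^ ((Fintype.card ι : ℝ) / 2) / Real.sqrt A.det := by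
  obtain ⟨Q, hQ⟩ : ∃ Q : Matrix ι ι ℝ, A = Q.transpose * Q := by
    open scoped MatrixOrder in
    obtain ⟨Q, hQ⟩ := CStarAlgebra.nonneg_iff_eq_star_mul_self.1 hA.posSemidef.nonneg
    exact ⟨Q, by simpa [Matrix.star_eq_conjTranspose] using hQ⟩
  have hdet : A.det = Q.det ^ 2 := by rw [hQ, Matrix.det_mul, Matrix.det_transpose, pow_two]
  have hQ0 : Q.det ≠ 0 := by
    have := hA.det_pos
    intro h
    simp [hdet, h] at this
  have hmap := Real.map_matrix_volume_pi_eq_smul_volume_pi hQ0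
  have hquad : ∀ y : ι → ℝ, y ⬝ᵥ A.mulVec y = ∑ i, (Q.mulVec y i) ^ 2 := by
    intro y
    rw [hQ, ← Matrix.mulVec_mulVec, Matrix.dotProduct_mulVec, Matrix.vecMul_transpose]
    simp [dotProduct, pow_two]
  have hcont : Continuous (Matrix.toLin' Q) := LinearMap.continuous_of_finiteDimensional _
  have hmeas : AEStronglyMeasurable (fun z : ι → ℝ => Real.exp (-(1 / 2) * ∑ i, z i ^ 2))
      (Measure.map (Matrix.toLin' Q) volume) :=
    Continuous.aestronglyMeasurable (by fun_prop)
  have h1 : ∫ y : ι → ℝ, Real.exp (-(1 / 2) * (y ⬝ᵥ A.mulVec y)) =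
      ∫ z, Real.exp (-(1 / 2) * ∑ i, z i ^ 2) ∂(Measure.map (Matrix.toLin' Q) volume) := by
    rw [integral_map hcont.aemeasurable hmeas]
    simp [hquad]
  have h2 : ∫ z : ι → ℝ, Real.exp (-(1 / 2) * ∑ i, z i ^ 2) =
      (2 * Real.pi) ^ ((Fintype.card ι : ℝ) / 2) := by
    have : ∀ z : ι → ℝ, Real.exp (-(1 / 2) * ∑ i, z i ^ 2) =
        ∏ i, Real.exp (-(1 / 2) * z i ^ 2) := by
      intro z; rw [← Real.exp_sum, Finset.mul_sum]
    simp_rw [this]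
    rw [integral_fintype_prod_volume_eq_pow (fun x : ℝ => Real.exp (-(1 / 2) * x ^ 2)),
      integral_gaussian, Real.sqrt_eq_rpow, ← Real.rpow_natCast, ← Real.rpow_mul (by positivity)]
    congr 1 <;> ring
  rw [h1, hmap, integral_smul_measure, h2, hdet, Real.sqrt_sq_eq_abs,
    ENNReal.toReal_ofReal (abs_nonneg _), abs_inv, smul_eq_mul]
  field_simp

theorem integral_comp_floor {ι : Type*} [Fintype ι] (F : (ι → ℤ) → ℝ)
    (hF : F.support.Finite) :
    ∫ z : ι → ℝ, F (fun i => ⌊z i⌋) = ∑ᶠ c, F c := by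
  classical
  have hcell : ∀ c : ι → ℤ, {z : ι → ℝ | (fun i => ⌊z i⌋) = c} =
      Set.univ.pi fun i => Set.Ico (c i : ℝ) (c i + 1) := by
    intro c; ext z
    simp [funext_iff, Int.floor_eq_iff]
  have hmeas : ∀ c : ι → ℤ, MeasurableSet {z : ι → ℝ | (fun i => ⌊z i⌋) = c} := by
    intro c; rw [hcell]
    exact MeasurableSet.univ_pi fun i => measurableSet_Ico
  have hvol : ∀ c : ι → ℤ, volume {z : ι → ℝ | (fun i => ⌊z i⌋) = c} = 1 := by
    intro c; rw [hcell, Real.volume_pi_Ico]; simp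
  have hsum : ∀ z : ι → ℝ, F (fun i => ⌊z i⌋) = ∑ c ∈ hF.toFinset,
      Set.indicator {z : ι → ℝ | (fun i => ⌊z i⌋) = c} (fun _ => F c) z := by
    intro z
    simp only [Set.indicator_apply, Set.mem_ofPred_eq]
    rw [Finset.sum_ite_eq]
    simp only [Set.Finite.mem_toFinset, Function.mem_support, ne_eq, ite_not]
    split_ifs with h <;> simp [h]
  simp_rw [hsum]
  rw [integral_finsetSum _ fun c _ => ?_,
    finsum_eq_sum_of_support_subset F (s := hF.toFinset) (by simp)]
  · refine Finset.sum_congr rfl fun c _ => ?_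
    rw [integral_indicator (hmeas c)]
    simp [measureReal_def, hvol]
  · exact (integrable_indicator_iff (hmeas c)).2 (by simp [hvol])

theorem Matrix.PosDef.exists_mul_norm_sq_le {ι : Type*} [Fintype ι] {A : Matrix ι ι ℝ}
    (hA : A.PosDef) : ∃ m > 0, ∀ u : ι → ℝ, m * ‖u‖ ^ 2 ≤ u ⬝ᵥ A.mulVec u := by
  have hpos : ∀ u ∈ Metric.sphere (0 : ι → ℝ) 1, 0 < u ⬝ᵥ A.mulVec u := by
    intro u hu
    have hu0 : u ≠ 0 := by rintro rfl; simp at hu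
    simpa using hA.dotProduct_mulVec_pos hu0
  have hcont : Continuous fun u : ι → ℝ => u ⬝ᵥ A.mulVec u :=
    continuous_id.dotProduct (continuous_const.matrix_mulVec continuous_id)
  obtain ⟨m, hm, hle⟩ := (isCompact_sphere (0 : ι → ℝ) 1).exists_forall_le' hcont.continuousOn hpos
  refine ⟨m, hm, fun u => ?_⟩
  rcases eq_or_ne u 0 with rfl | hu
  · simp
  have hnu : ‖u‖ ≠ 0 := norm_ne_zero_iff.2 hu
  have h := hle (‖u‖⁻¹ • u) (by simp [norm_smul, hnu])
  rw [Matrix.mulVec_smul, smul_dotProduct, dotProduct_smul, smul_eq_mul, smul_eq_mul] at h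
  calc m * ‖u‖ ^ 2 ≤ ‖u‖⁻¹ * (‖u‖⁻¹ * (u ⬝ᵥ A.mulVec u)) * ‖u‖ ^ 2 := by gcongr
    _ = u ⬝ᵥ A.mulVec u := by field_simp

theorem exists_sub_le_neg_mul_norm_sq {ι : Type*} [Fintype ι] {A : Matrix ι ι ℝ} (hA : A.PosDef)
    {S : Set (ι → ℝ)} (hS : IsCompact S) {f : (ι → ℝ) → ℝ} (hf : ContinuousOn f S)
    (hmax : ∀ u ∈ S, u ≠ 0 → f u < f 0)
    (htaylor : (fun u => f u - f 0 + 1 / 2 * (u ⬝ᵥ A.mulVec u)) =o[𝓝 0] fun u => ‖u‖ ^ 2) :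
    ∃ κ > 0, ∀ u ∈ S, f u - f 0 ≤ -κ * ‖u‖ ^ 2 := by
  obtain ⟨m, hm, hle⟩ := hA.exists_mul_norm_sq_le
  obtain ⟨ρ, hρ, hball⟩ := Metric.eventually_nhds_iff_ball.1
    ((isLittleO_iff.1 htaylor) (show 0 < m / 4 by positivity))
  have hcpt : IsCompact (S \ Metric.ball 0 ρ) := hS.diff Metric.isOpen_ball
  obtain ⟨η, hη, hηle⟩ := hcpt.exists_forall_le' (f := fun u => f 0 - f u) (a := 0)
    ((continuousOn_const.sub hf).mono Set.sdiff_subset) (by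
      rintro u ⟨huS, hu⟩
      refine sub_pos.2 (hmax u huS ?_)
      rintro rfl
      exact hu (Metric.mem_ball_self hρ))
  obtain ⟨R, hR⟩ := hS.isBounded.exists_norm_le
  refine ⟨min (m / 4) (η / (R ^ 2 + 1)), by positivity, fun u hu => ?_⟩
  by_cases hub : u ∈ Metric.ball 0 ρ
  · have h1 := hball u hub
    rw [Real.norm_eq_abs, Real.norm_eq_abs, abs_of_nonneg (sq_nonneg ‖u‖)] at h1
    have h2 := (abs_le.1 h1).2
    have h3 := hle u
    have h4 : min (m / 4) (η / (R ^ 2 + 1)) * ‖u‖ ^ 2 ≤ m / 4 * ‖u‖ ^ 2 := by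
      gcongr; exact min_le_left _ _
    linarith
  · have h1 := hηle u ⟨hu, hub⟩
    have h2 : ‖u‖ ^ 2 ≤ R ^ 2 + 1 := by
      have := pow_le_pow_left₀ (norm_nonneg u) (hR u hu) 2
      linarith
    have h4 : min (m / 4) (η / (R ^ 2 + 1)) * ‖u‖ ^ 2 ≤ η / (R ^ 2 + 1) * (R ^ 2 + 1) := by
      gcongr; exact min_le_right _ _
    rw [div_mul_cancel₀ _ (by positivity)] at h4
    linarith

theorem integrable_exp_neg_mul_norm_sq {ι : Type*} [Fintype ι] {κ : ℝ} (hκ : 0 < κ) :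
    Integrable fun y : ι → ℝ => Real.exp (-κ * ‖y‖ ^ 2) := by
  set k : ℝ := κ / (Fintype.card ι + 1) with hk
  have hk0 : 0 < k := by positivity
  have hint : Integrable fun y : ι → ℝ => ∏ i, Real.exp (-k * y i ^ 2) :=
    Integrable.fintype_prod fun _ => integrable_exp_neg_mul_sq hk0
  refine hint.mono' (Continuous.aestronglyMeasurable (by fun_prop)) (ae_of_all _ fun y => ?_)
  rw [Real.norm_eq_abs, Real.abs_exp, ← Real.exp_sum, ← Finset.mul_sum, Real.exp_le_exp]
  have hsum : ∑ i, y i ^ 2 ≤ Fintype.card ι * ‖y‖ ^ 2 := by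
    rw [← nsmul_eq_mul, ← Finset.card_univ, ← Finset.sum_const]
    refine Finset.sum_le_sum fun i _ => ?_
    rw [← sq_abs (y i), ← Real.norm_eq_abs]
    gcongr
    exact norm_le_pi_norm y i
  have : k * ∑ i, y i ^ 2 ≤ κ * ‖y‖ ^ 2 := by
    calc k * ∑ i, y i ^ 2 ≤ k * ((Fintype.card ι + 1) * ‖y‖ ^ 2) := by
          gcongr; nlinarith [sq_nonneg ‖y‖]
      _ = κ * ‖y‖ ^ 2 := by rw [hk]; field_simp
  linarith

theorem finite_setOf_smul_intCast_add_mem {ι : Type*} [Finite ι] {S : Set (ι → ℝ)}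
    (hS : Bornology.IsBounded S) {a : ℝ} (ha : 0 < a) (t : ι → ℝ) :
    {c : ι → ℤ | a⁻¹ • ((fun i => (c i : ℝ)) + t) ∈ S}.Finite := by
  classical
  have := Fintype.ofFinite ι
  obtain ⟨R, hR⟩ := hS.exists_norm_le
  refine (Set.finite_Icc (fun i => ⌈-(a * R) - t i⌉) (fun i => ⌊a * R - t i⌋)).subset ?_
  intro c hc
  have key : ∀ i, |(c i : ℝ) + t i| ≤ a * R := by
    intro i
    have h := (norm_le_pi_norm _ i).trans (hR _ hc)
    simp only [Pi.smul_apply, Pi.add_apply, smul_eq_mul, norm_mul, norm_inv, Real.norm_eq_abs,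
      abs_of_pos ha] at h
    rwa [inv_mul_le_iff₀ ha] at h
  constructor <;> intro i
  · exact Int.ceil_le.2 (by linarith [(abs_le.1 (key i)).1])
  · exact Int.le_floor.2 (by linarith [(abs_le.1 (key i)).2])

theorem tendsto_laplace_lattice_sum {ι : Type*} [Fintype ι] [DecidableEq ι] {A : Matrix ι ι ℝ}
    (hA : A.PosDef) {S S₁ : Set (ι → ℝ)} (hS : IsCompact S) (hS₁ : S₁ ∈ 𝓝 0)
    {f g : (ι → ℝ) → ℝ} (hf : ContinuousOn f S) (hg : ContinuousAt g 0)
    (hmax : ∀ u ∈ S, u ≠ 0 → f u < f 0)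
    (htaylor : (fun u => f u - f 0 + 1 / 2 * (u ⬝ᵥ A.mulVec u)) =o[𝓝 0] fun u => ‖u‖ ^ 2)
    (t : ℕ → ι → ℝ) (F : ℕ → (ι → ℤ) → ℝ) (u : ℕ → (ι → ℤ) → ι → ℝ)
    (hu : ∀ n c, u n c = (n : ℝ)⁻¹ • ((fun i => (c i : ℝ)) + t n))
    {C : ℝ} {ε δ : ℕ → ℝ} (hε : Tendsto ε atTop (𝓝 0)) (hδ : Tendsto δ atTop (𝓝 0))
    (hzero : ∀ n : ℕ, 1 ≤ n → ∀ c, u n c ∉ S → F n c = 0)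
    (hbig : ∀ n : ℕ, 1 ≤ n → ∀ c, u n c ∈ S →
      |F n c| ≤ C * Real.exp (n * (f (u n c) - f 0) + n * ε n))
    (hloc : ∀ n : ℕ, 1 ≤ n → ∀ c, u n c ∈ S₁ →
      |F n c - g (u n c) * Real.exp (n * (f (u n c) - f 0))| ≤
        δ n * Real.exp (n * (f (u n c) - f 0))) :
    Tendsto (fun n : ℕ => ((n : ℝ) ^ ((Fintype.card ι : ℝ) / 2))⁻¹ * ∑ᶠ c, F n c) atTop
      (𝓝 (g 0 * ((2 * Real.pi) ^ ((Fintype.card ι : ℝ) / 2) / Real.sqrt A.det))) := by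
  obtain ⟨κ, hκ, hquad⟩ := exists_sub_le_neg_mul_norm_sq hA hS hf hmax htaylor
  have hbound : ∃ C' : ℝ, 0 ≤ C' ∧ ∀ᶠ n : ℕ in atTop, ∀ c,
      |F n c| ≤ C' * Real.exp (-(κ / 2) * (n * ‖u n c‖ ^ 2)) := by
    have hgb : ∀ᶠ x in 𝓝 (0 : ι → ℝ), |g x| < |g 0| + 1 :=
      hg.abs.eventually_lt_const (by linarith)
    obtain ⟨ρ, hρ, hball⟩ := Metric.eventually_nhds_iff_ball.1 (hgb.and hS₁)
    refine ⟨|g 0| + 2 + |C|, by positivity, ?_⟩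
    filter_upwards [eventually_ge_atTop 1, hδ.eventually_lt_const one_pos,
      hε.eventually_lt_const (show 0 < κ / 2 * ρ ^ 2 by positivity)] with n hn hδn hεn c
    by_cases hcS : u n c ∈ S
    swap
    · rw [hzero n hn c hcS, abs_zero]; positivity
    have hn0 : (0 : ℝ) < n := by exact_mod_cast hn
    have hq := mul_le_mul_of_nonneg_left (hquad _ hcS) hn0.le
    have hsq : 0 ≤ (n : ℝ) * ‖u n c‖ ^ 2 := by positivity
    by_cases hcb : u n c ∈ Metric.ball 0 ρ
    · obtain ⟨hgc, hc1⟩ := hball _ hcb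
      have h1 := hloc n hn c hc1
      have h2 : |F n c| ≤ (|g (u n c)| + δ n) * Real.exp (n * (f (u n c) - f 0)) := by
        have := abs_sub_abs_le_abs_sub (F n c) (g (u n c) * Real.exp (n * (f (u n c) - f 0)))
        rw [abs_mul, Real.abs_exp] at this
        linarith
      refine h2.trans (mul_le_mul ?_ (Real.exp_le_exp.2 ?_) (Real.exp_pos _).le (by positivity))
      · linarith [abs_nonneg C]
      · nlinarith
    · have hρle : ρ ≤ ‖u n c‖ := by simpa using hcb
      have hρsq : ρ ^ 2 ≤ ‖u n c‖ ^ 2 := by gcongr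
      have h3 : ε n ≤ κ / 2 * ‖u n c‖ ^ 2 := hεn.le.trans (by gcongr)
      have h4 := mul_le_mul_of_nonneg_left h3 hn0.le
      refine (hbig n hn c hcS).trans
        (mul_le_mul ?_ (Real.exp_le_exp.2 ?_) (Real.exp_pos _).le (by positivity))
      · linarith [abs_nonneg (g 0), le_abs_self C]
      · nlinarith
  obtain ⟨C', hC', hbound⟩ := hbound
  let P : ℕ → (ι → ℝ) → ι → ℤ := fun n y i => ⌊(√(n : ℝ) • y - t n) i⌋
  have hdist : ∀ n : ℕ, 1 ≤ n → ∀ y, ‖√(n : ℝ) • u n (P n y) - y‖ ≤ (√(n : ℝ))⁻¹ := by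
    intro n hn y
    have hn0 : (0 : ℝ) < n := by exact_mod_cast hn
    have hs0 : 0 < √(n : ℝ) := Real.sqrt_pos.2 hn0
    refine (pi_norm_le_iff_of_nonneg (by positivity)).2 fun i => ?_
    have h1 := Int.floor_le (√(n : ℝ) * y i - t n i)
    have h2 := Int.lt_floor_add_one (√(n : ℝ) * y i - t n i)
    have hinv : √(n : ℝ) * (n : ℝ)⁻¹ = (√(n : ℝ))⁻¹ := by
      rw [← div_eq_mul_inv, Real.sqrt_div_self]
    have heq : (√(n : ℝ) • u n (P n y) - y) i =
        (√(n : ℝ))⁻¹ * ((⌊√(n : ℝ) * y i - t n i⌋ : ℝ) + t n i - √(n : ℝ) * y i) := by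
      simp only [hu, P, Pi.sub_apply, Pi.smul_apply, Pi.add_apply, smul_eq_mul]
      rw [← mul_assoc, hinv, mul_sub, inv_mul_cancel_left₀ hs0.ne']
    rw [heq, norm_mul, norm_inv, Real.norm_eq_abs, Real.norm_eq_abs, abs_of_pos hs0]
    refine mul_le_of_le_one_right (by positivity) (abs_le.2 ⟨?_, ?_⟩) <;> linarith
  have hnorm : ∀ (n : ℕ) c, (n : ℝ) * ‖u n c‖ ^ 2 = ‖√(n : ℝ) • u n c‖ ^ 2 := by
    intro n c
    rw [norm_smul, mul_pow, Real.norm_eq_abs, sq_abs, Real.sq_sqrt (by positivity)]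
  have hintegral : ∀ᶠ n : ℕ in atTop, ∫ y, F n (P n y) =
      ((n : ℝ) ^ ((Fintype.card ι : ℝ) / 2))⁻¹ * ∑ᶠ c, F n c := by
    filter_upwards [eventually_ge_atTop 1] with n hn
    have hn0 : (0 : ℝ) < n := by exact_mod_cast hn
    have hfin : (F n).support.Finite := by
      refine (finite_setOf_smul_intCast_add_mem hS.isBounded hn0 (t n)).subset fun c hc => ?_
      by_contra hcS
      exact hc (hzero n hn c (by rwa [hu]))
    rw [← integral_comp_floor _ hfin,
      Measure.integral_comp_smul volume (fun z => F n fun i => ⌊(z - t n) i⌋),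
      integral_sub_right_eq_self (fun z : ι → ℝ => F n fun i => ⌊z i⌋), smul_eq_mul,
      abs_of_nonneg (by positivity), Module.finrank_fintype_fun_eq_card, Real.sqrt_eq_rpow,
      ← Real.rpow_natCast, ← Real.rpow_mul hn0.le]
    rw [one_div_mul_eq_div]
  rw [← integral_exp_neg_half_quadratic hA, ← integral_const_mul]
  refine Tendsto.congr' hintegral (tendsto_integral_filter_of_dominated_convergence
    (fun y => C' * Real.exp (κ / 2) * Real.exp (-(κ / 4) * ‖y‖ ^ 2)) ?_ ?_ ?_ ?_)
  · refine Eventually.of_forall fun n => Measurable.aestronglyMeasurable ?_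
    refine (measurable_of_countable (F n)).comp (measurable_pi_iff.2 fun i => ?_)
    exact Int.measurable_floor.comp (by fun_prop)
  · filter_upwards [hbound, eventually_ge_atTop 1] with n hn hn1
    refine ae_of_all _ fun y => (hn _).trans ?_
    rw [mul_assoc, ← Real.exp_add, hnorm]
    refine mul_le_mul_of_nonneg_left (Real.exp_le_exp.2 ?_) hC'
    have hs1 : (√(n : ℝ))⁻¹ ≤ 1 := inv_le_one_of_one_le₀ (by simpa using hn1)
    have h1 : ‖y‖ ≤ ‖√(n : ℝ) • u n (P n y)‖ + 1 := by
      have := norm_sub_norm_le y (√(n : ℝ) • u n (P n y))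
      rw [norm_sub_rev] at this
      linarith [hdist n hn1 y]
    have h2 : ‖y‖ ^ 2 ≤ 2 * ‖√(n : ℝ) • u n (P n y)‖ ^ 2 + 2 := by
      nlinarith [norm_nonneg y, sq_nonneg (‖√(n : ℝ) • u n (P n y)‖ - 1)]
    nlinarith
  · exact (integrable_exp_neg_mul_norm_sq (by positivity)).const_mul _
  · refine ae_of_all _ fun y => ?_
    have hsinv : Tendsto (fun n : ℕ => (√(n : ℝ))⁻¹) atTop (𝓝 0) :=
      tendsto_inv_atTop_zero.comp (Real.tendsto_sqrt_atTop.comp tendsto_natCast_atTop_atTop)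
    have hp : Tendsto (fun n : ℕ => √(n : ℝ) • u n (P n y)) atTop (𝓝 y) := by
      rw [tendsto_iff_norm_sub_tendsto_zero]
      refine squeeze_zero' (Eventually.of_forall fun _ => norm_nonneg _) ?_ hsinv
      filter_upwards [eventually_ge_atTop 1] with n hn using hdist n hn y
    have hu0 : Tendsto (fun n : ℕ => u n (P n y)) atTop (𝓝 0) := by
      have := hsinv.smul hp
      rw [zero_smul] at this
      refine this.congr' ?_
      filter_upwards [eventually_ge_atTop 1] with n hn
      have hs0 : √(n : ℝ) ≠ 0 := (Real.sqrt_pos.2 (by exact_mod_cast hn)).ne'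
      rw [smul_smul, inv_mul_cancel₀ hs0, one_smul]
    have hrem : Tendsto (fun n : ℕ => (n : ℝ) * (f (u n (P n y)) - f 0 +
        1 / 2 * (u n (P n y) ⬝ᵥ A.mulVec (u n (P n y))))) atTop (𝓝 0) := by
      have h1 := (htaylor.comp_tendsto hu0)
      have h2 := (isBigO_refl (fun n : ℕ => (n : ℝ)) atTop).mul_isLittleO h1
      refine (h2.congr_right fun n => hnorm n (P n y)).trans_isBigO ?_ |>.tendsto_zero_of_tendsto
        (tendsto_const_nhds (x := (1 : ℝ)))
      exact (hp.norm.pow 2).isBigO_one ℝ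
    have hqc : Continuous fun u : ι → ℝ => u ⬝ᵥ A.mulVec u :=
      continuous_id.dotProduct (continuous_const.matrix_mulVec continuous_id)
    have hexp : Tendsto (fun n : ℕ => Real.exp (n * (f (u n (P n y)) - f 0))) atTop
        (𝓝 (Real.exp (-(1 / 2) * (y ⬝ᵥ A.mulVec y)))) := by
      refine (Real.continuous_exp.tendsto _).comp ?_
      have h3 := hrem.sub (((hqc.tendsto y).comp hp).const_mul (1 / 2 : ℝ))
      rw [zero_sub, ← neg_mul] at h3
      refine h3.congr fun n => ?_
      simp only [Function.comp_apply, Matrix.mulVec_smul, smul_dotProduct, dotProduct_smul,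
        smul_eq_mul]
      rw [← mul_assoc √(n : ℝ), Real.mul_self_sqrt (Nat.cast_nonneg n)]
      ring
    have hmain := (hg.tendsto.comp hu0).mul hexp
    have herr : Tendsto (fun n : ℕ => F n (P n y) -
        g (u n (P n y)) * Real.exp (n * (f (u n (P n y)) - f 0))) atTop (𝓝 0) := by
      have h4 := hδ.mul hexp
      rw [zero_mul] at h4
      refine squeeze_zero_norm' ?_ h4
      filter_upwards [eventually_ge_atTop 1, hu0.eventually_mem hS₁] with n hn hn1
      exact hloc n hn _ hn1
    have h5 := herr.add hmain
    rw [zero_add] at h5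
    exact h5.congr fun n => by simp

theorem dotProduct_mulVec_nonneg_of_isLocalMax {ι : Type*} [Fintype ι] {A : Matrix ι ι ℝ}
    {f : (ι → ℝ) → ℝ} (hmax : IsLocalMax f 0)
    (htaylor : (fun u => f u - f 0 + 1 / 2 * (u ⬝ᵥ A.mulVec u)) =o[𝓝 0] fun u => ‖u‖ ^ 2)
    (u : ι → ℝ) : 0 ≤ u ⬝ᵥ A.mulVec u := by
  have hs : Tendsto (fun k : ℕ => 1 / ((k : ℝ) + 1)) atTop (𝓝 0) :=
    tendsto_one_div_add_atTop_nhds_zero_nat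
  have hsu : Tendsto (fun k : ℕ => (1 / ((k : ℝ) + 1)) • u) atTop (𝓝 0) := by
    simpa using hs.smul_const u
  have ho : (fun k : ℕ => f ((1 / ((k : ℝ) + 1)) • u) - f 0 +
      1 / 2 * (((1 / ((k : ℝ) + 1)) • u) ⬝ᵥ A.mulVec ((1 / ((k : ℝ) + 1)) • u)))
      =o[atTop] fun k : ℕ => (1 / ((k : ℝ) + 1)) ^ 2 := by
    refine (htaylor.comp_tendsto hsu).trans_isBigO ?_
    refine IsBigO.of_bound (‖u‖ ^ 2) (Eventually.of_forall fun k => le_of_eq ?_)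
    simp only [Function.comp_apply, norm_smul, norm_pow, norm_mul, norm_norm, mul_pow]
    ring
  have hle := le_of_tendsto (b := u ⬝ᵥ A.mulVec u / 2)
    (x := atTop) ho.tendsto_div_nhds_zero ?_
  · linarith
  filter_upwards [hsu.eventually hmax] with k hk
  have hk0 : (0 : ℝ) < 1 / ((k : ℝ) + 1) := by positivity
  rw [div_le_iff₀ (by positivity)]
  simp only [Matrix.mulVec_smul, smul_dotProduct, dotProduct_smul, smul_eq_mul]
  nlinarith

theorem isLittleO_taylor_two_comp_of_isLocalMax {E G : Type*} [NormedAddCommGroup E]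
    [NormedSpace ℝ E] [NormedAddCommGroup G] [NormedSpace ℝ G] {φ : G → ℝ} {x : G}
    (hφ : ContDiffAt ℝ 2 φ x) (B : E →L[ℝ] G) (hmax : IsLocalMax (fun u => φ (x + B u)) 0) :
    (fun u => φ (x + B u) - φ x - 1 / 2 * fderiv ℝ (fderiv ℝ φ) x (B u) (B u))
      =o[𝓝 0] fun u => ‖u‖ ^ 2 := by
  have hB0 : Tendsto B (𝓝 0) (𝓝 0) := B.continuous.tendsto' _ _ (map_zero B)
  have hgrad : ∀ u, fderiv ℝ φ x (B u) = 0 := by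
    have hd : HasFDerivAt (fun u => φ (x + B u)) ((fderiv ℝ φ x).comp B) 0 := by
      refine HasFDerivAt.comp (g := φ) (0 : E) ?_ (B.hasFDerivAt.const_add x)
      rw [map_zero, add_zero]
      exact (hφ.differentiableAt (by norm_num)).hasFDerivAt
    intro u
    exact DFunLike.congr_fun (hmax.hasFDerivAt_eq_zero hd) u
  have h := (hφ.isLittleO_taylor_two.comp_tendsto hB0).trans_isBigO
    ((B.isBigO_id (𝓝 0)).norm_norm.pow 2)
  refine h.congr_left fun u => ?_
  simp [hgrad]

theorem finsum_mem_setOf_sub_mem_lattice {E ι : Type*} [AddCommGroup E] [Module ℝ E] [Fintype ι]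
    {b : ι → E} (hb : LinearIndependent ℝ b) (p : E) (T : E → Prop) (a : E → ℝ) :
    ∑ᶠ ℓ ∈ {ℓ : E | ℓ - p ∈ {x | ∃ c : ι → ℤ, x = ∑ i, (c i : ℝ) • b i} ∧ T ℓ}, a ℓ =
      ∑ᶠ c : ι → ℤ, Set.indicator {ℓ | T ℓ} a (p + ∑ i, (c i : ℝ) • b i) := by
  have hinj : Function.Injective fun c : ι → ℤ => p + ∑ i, (c i : ℝ) • b i := by
    intro c c' h
    have h1 := (linearIndependent_iff_injective_fintypeLinearCombination.1 hb)
      (a₁ := fun i => (c i : ℝ)) (a₂ := fun i => (c' i : ℝ))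
      (by simpa [Fintype.linearCombination_apply] using h)
    funext i
    exact_mod_cast congrFun h1 i
  have himage : {ℓ : E | ℓ - p ∈ {x | ∃ c : ι → ℤ, x = ∑ i, (c i : ℝ) • b i} ∧ T ℓ} =
      (fun c : ι → ℤ => p + ∑ i, (c i : ℝ) • b i) '' {c | T (p + ∑ i, (c i : ℝ) • b i)} := by
    ext ℓ
    simp only [Set.mem_ofPred_eq, Set.mem_image]
    constructor
    · rintro ⟨⟨c, hc⟩, hT⟩
      have hℓ : p + ∑ i, (c i : ℝ) • b i = ℓ := by rw [← hc]; abel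
      exact ⟨c, by rwa [hℓ], hℓ⟩
    · rintro ⟨c, hT, rfl⟩
      exact ⟨⟨c, by abel⟩, hT⟩
  rw [himage, finsum_mem_image hinj.injOn, finsum_mem_def]
  rfl

theorem stmt_0 (N r : ℕ) (hrN : r ≤ N)
    (b : Fin r → (Fin N → ℝ)) (hb : LinearIndependent ℝ b)
    (L : Set (Fin N → ℝ))
    (hLdef : L = {x | ∃ c : Fin r → ℤ, x = ∑ i, (c i : ℝ) • b i})
    (Vsub : Submodule ℝ (Fin N → ℝ)) (hV : Vsub = Submodule.span ℝ (Set.range b))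
    (w : Fin N → ℝ) (W : Set (Fin N → ℝ)) (hW : W = {x | x - w ∈ Vsub})
    (K K₁ : Set (Fin N → ℝ))
    (hKcpt : IsCompact K) (hKconv : Convex ℝ K) (hKint : (interior K).Nonempty)
    (φ ψ : (Fin N → ℝ) → ℝ) (hφcont : ContinuousOn φ K)
    (x₀ : Fin N → ℝ) (hx₀K : x₀ ∈ interior K) (hx₀W : x₀ ∈ W)
    (hmax : ∀ x ∈ K ∩ W, x ≠ x₀ → φ x < φ x₀)
    (hsmooth : ∃ U : Set (Fin N → ℝ), IsOpen U ∧ x₀ ∈ U ∧ ContDiffOn ℝ 2 φ U)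
    (hK₁ : K₁ ⊆ K) (hK₁nhds : K₁ ∈ nhds x₀)
    (hψcont : ContinuousOn ψ K₁) (hψpos : 0 < ψ x₀)
    (ℓn : ℕ → (Fin N → ℝ)) (hℓn : ∀ n : ℕ, 1 ≤ n → (n : ℝ)⁻¹ • ℓn n ∈ W)
    (bn : ℕ → ℝ) (hbn : ∀ n, 0 < bn n)
    (an : ℕ → (Fin N → ℝ) → ℝ)
    (hbig : ∃ C : ℝ, ∃ ε : ℕ → ℝ, Filter.Tendsto ε Filter.atTop (nhds 0) ∧
      ∀ n : ℕ, 1 ≤ n → ∀ ℓ : Fin N → ℝ, ℓ - ℓn n ∈ L → (n : ℝ)⁻¹ • ℓ ∈ K →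
        |an n ℓ| ≤ C * bn n * Real.exp (n * φ ((n : ℝ)⁻¹ • ℓ) + n * ε n))
    (hloc : ∃ δ : ℕ → ℝ, Filter.Tendsto δ Filter.atTop (nhds 0) ∧
      ∀ n : ℕ, 1 ≤ n → ∀ ℓ : Fin N → ℝ, ℓ - ℓn n ∈ L → (n : ℝ)⁻¹ • ℓ ∈ K₁ →
        |an n ℓ - bn n * ψ ((n : ℝ)⁻¹ • ℓ) * Real.exp (n * φ ((n : ℝ)⁻¹ • ℓ))| ≤
          bn n * δ n * Real.exp (n * φ ((n : ℝ)⁻¹ • ℓ)))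
    (detH : ℝ)
    (hdetH : detH =
      Matrix.det (Matrix.of fun i j : Fin r =>
          -((fderiv ℝ (fderiv ℝ φ) x₀ (b i)) (b j))) /
        Matrix.det (Matrix.of fun i j : Fin r => ∑ t, b i t * b j t))
    (hdetH0 : detH ≠ 0) :
    Asymptotics.IsEquivalent Filter.atTop
      (fun n : ℕ => ∑ᶠ ℓ ∈ {ℓ : Fin N → ℝ | ℓ - ℓn n ∈ L ∧ (n : ℝ)⁻¹ • ℓ ∈ K}, an n ℓ)
      (fun n : ℕ =>
        (2 * Real.pi) ^ ((r : ℝ) / 2) * ψ x₀ /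
          (Real.sqrt (Matrix.det (Matrix.of fun i j => ∑ t, b i t * b j t)) *
            Real.sqrt detH) *
        bn n * (n : ℝ) ^ ((r : ℝ) / 2) * Real.exp (n * φ x₀)) := by
  obtain ⟨U, hUo, hxU, hU⟩ := hsmooth
  have hφ : ContDiffAt ℝ 2 φ x₀ := hU.contDiffAt (hUo.mem_nhds hxU)
  obtain ⟨C, ε, hε, hbig⟩ := hbig
  obtain ⟨δ, hδ, hloc⟩ := hloc
  set Gram : Matrix (Fin r) (Fin r) ℝ := Matrix.of fun i j => ∑ t, b i t * b j t with hGram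
  set A : Matrix (Fin r) (Fin r) ℝ :=
    Matrix.of fun i j => -((fderiv ℝ (fderiv ℝ φ) x₀ (b i)) (b j)) with hAdef
  let B : (Fin r → ℝ) →L[ℝ] (Fin N → ℝ) := (Fintype.linearCombination ℝ b).toContinuousLinearMap
  have hB : ∀ y, B y = ∑ i, y i • b i := fun y => Fintype.linearCombination_apply ℝ b y
  have hBinj : Function.Injective B := linearIndependent_iff_injective_fintypeLinearCombination.1 hb
  have hBV : ∀ v, v ∈ Vsub ↔ ∃ y, B y = v := by
    intro v
    rw [hV, ← Fintype.range_linearCombination ℝ b]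
    rfl
  have hxB : ∀ y, x₀ + B y ∈ W := by
    intro y
    rw [hW] at hx₀W ⊢
    have := Vsub.add_mem hx₀W ((hBV _).2 ⟨y, rfl⟩)
    rwa [sub_add_eq_add_sub] at this
  have hcont : Continuous fun u => x₀ + B u := by fun_prop
  have hcont0 : Tendsto (fun u => x₀ + B u) (𝓝 0) (𝓝 x₀) := hcont.tendsto' _ _ (by simp)
  set S : Set (Fin r → ℝ) := (fun u => x₀ + B u) ⁻¹' K
  have hS : IsCompact S :=
    ((Homeomorph.addLeft x₀).isClosedEmbedding.comp
      (LinearMap.isClosedEmbedding_of_injective (LinearMap.ker_eq_bot.2 hBinj))).isCompact_preimage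
      hKcpt
  have hSmax : ∀ u ∈ S, u ≠ 0 → φ (x₀ + B u) < φ (x₀ + B 0) := by
    intro u hu hu0
    rw [map_zero, add_zero]
    refine hmax _ ⟨hu, hxB u⟩ fun h => hu0 (hBinj ?_)
    rw [map_zero]
    exact add_eq_left.1 h
  have hlocmax : IsLocalMax (fun u => φ (x₀ + B u)) 0 := by
    filter_upwards [hcont0.eventually_mem (mem_interior_iff_mem_nhds.1 hx₀K)] with u hu
    rcases eq_or_ne u 0 with rfl | hu0
    · exact le_rfl
    · exact (hSmax u hu hu0).le
  have hAquad : ∀ u, u ⬝ᵥ A.mulVec u = -(fderiv ℝ (fderiv ℝ φ) x₀ (B u) (B u)) := by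
    intro u
    simp only [hB, map_sum, map_smul, FunLike.coe_sum, Finset.sum_apply, FunLike.coe_smul,
      Pi.smul_apply, smul_eq_mul, dotProduct, Matrix.mulVec, hAdef, Matrix.of_apply,
      Finset.mul_sum, ← Finset.sum_neg_distrib]
    rw [Finset.sum_comm]
    refine Finset.sum_congr rfl fun i _ => Finset.sum_congr rfl fun j _ => ?_
    ring
  have htaylor : (fun u => φ (x₀ + B u) - φ (x₀ + B 0) + 1 / 2 * (u ⬝ᵥ A.mulVec u))
      =o[𝓝 0] fun u => ‖u‖ ^ 2 := by
    refine (isLittleO_taylor_two_comp_of_isLocalMax hφ B hlocmax).congr_left fun u => ?_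
    rw [hAquad, map_zero, add_zero]
    ring
  have hGram0 : Gram.det ≠ 0 := by
    rintro h
    rw [h, div_zero] at hdetH
    exact hdetH0 hdetH
  have hGrampos : 0 < Gram.det := by
    refine lt_of_le_of_ne ?_ hGram0.symm
    have h := (Matrix.posSemidef_self_mul_conjTranspose (Matrix.of b)).det_nonneg
    have heq : Gram = Matrix.of b * (Matrix.of b).conjTranspose := by
      ext i j
      simp [hGram, Matrix.mul_apply]
    rwa [heq]
  have hdet : A.det = Gram.det * detH := by
    rw [hdetH, mul_div_cancel₀ _ hGram0]
  have hApos : A.PosDef := by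
    have hsymm : IsSymmSndFDerivAt ℝ φ x₀ := hφ.isSymmSndFDerivAt (by simp)
    have hsemi : A.PosSemidef := by
      refine Matrix.PosSemidef.of_dotProduct_mulVec_nonneg ?_ fun u => ?_
      · ext i j
        simp [hAdef, hsymm.eq (b j) (b i)]
      · simpa using dotProduct_mulVec_nonneg_of_isLocalMax hlocmax htaylor u
    exact hsemi.posDef_iff_det_ne_zero.2 (hdet ▸ mul_ne_zero hGram0 hdetH0)
  have hdetHpos : 0 < detH := by
    have := hApos.det_pos
    rw [hdet] at this
    exact (mul_pos_iff_of_pos_left hGrampos).1 this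
  have hexists : ∀ n : ℕ, ∃ t, 1 ≤ n → B t = ℓn n - (n : ℝ) • x₀ := by
    intro n
    by_cases hn : 1 ≤ n
    swap
    · exact ⟨0, fun h => absurd h hn⟩
    have hn0 : (n : ℝ) ≠ 0 := by positivity
    have h1 := hℓn n hn
    rw [hW] at h1 hx₀W
    have h2 := Vsub.smul_mem (n : ℝ) (Vsub.sub_mem h1 hx₀W)
    rw [sub_sub_sub_cancel_right, smul_sub, smul_inv_smul₀ hn0] at h2
    obtain ⟨t, ht⟩ := (hBV _).1 h2
    exact ⟨t, fun _ => ht⟩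
  choose t ht using hexists
  let u : ℕ → (Fin r → ℤ) → Fin r → ℝ := fun n c => (n : ℝ)⁻¹ • ((fun i => (c i : ℝ)) + t n)
  let pt : ℕ → (Fin r → ℤ) → Fin N → ℝ := fun n c => ℓn n + ∑ i, (c i : ℝ) • b i
  have hpt : ∀ n : ℕ, 1 ≤ n → ∀ c, (n : ℝ)⁻¹ • pt n c = x₀ + B (u n c) := by
    intro n hn c
    have hn0 : (n : ℝ) ≠ 0 := by positivity
    simp only [u, pt]
    rw [map_smul, map_add, ht n hn, ← hB, smul_add, smul_add, smul_sub, inv_smul_smul₀ hn0]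
    abel
  have hptL : ∀ n c, pt n c - ℓn n ∈ L := by
    intro n c
    rw [hLdef]
    exact ⟨c, by simp [pt]⟩
  let F : ℕ → (Fin r → ℤ) → ℝ := fun n c => (bn n * Real.exp (n * φ x₀))⁻¹ *
    Set.indicator {ℓ : Fin N → ℝ | (n : ℝ)⁻¹ • ℓ ∈ K} (an n) (pt n c)
  have hF : ∀ n : ℕ, 1 ≤ n → ∀ c, u n c ∈ S →
      F n c = (bn n * Real.exp (n * φ x₀))⁻¹ * an n (pt n c) := by
    intro n hn c hc
    have : pt n c ∈ {ℓ : Fin N → ℝ | (n : ℝ)⁻¹ • ℓ ∈ K} := by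
      rw [Set.mem_ofPred_eq, hpt n hn]; exact hc
    simp only [F, Set.indicator_of_mem this]
  have hlim := tendsto_laplace_lattice_sum hApos hS (hcont0.eventually_mem hK₁nhds)
    (f := fun u => φ (x₀ + B u)) (g := fun u => ψ (x₀ + B u)) (C := C)
    (hφcont.comp hcont.continuousOn fun _ h => h)
    (ContinuousAt.comp (g := ψ) (by simpa using hψcont.continuousAt hK₁nhds) hcont.continuousAt)
    hSmax htaylor t F u (fun _ _ => rfl) hε hδ ?_ ?_ ?_
  · rw [Fintype.card_fin] at hlim
    simp only [map_zero, add_zero] at hlim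
    rw [hdet, Real.sqrt_mul hGrampos.le] at hlim
    set c₀ : ℝ := ψ x₀ * ((2 * Real.pi) ^ ((r : ℝ) / 2) / (√Gram.det * √detH)) with hc₀
    have hc₀pos : 0 < c₀ := by positivity
    refine isEquivalent_of_tendsto_one ?_
    have h1 := hlim.div_const c₀
    rw [div_self hc₀pos.ne'] at h1
    refine h1.congr' ?_
    filter_upwards [eventually_ge_atTop 1] with n hn
    have hn0 : (0 : ℝ) < n := by exact_mod_cast hn
    have hbpos := hbn n
    have hsum : ∑ᶠ c, F n c = (bn n * Real.exp (n * φ x₀))⁻¹ *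
        ∑ᶠ ℓ ∈ {ℓ : Fin N → ℝ | ℓ - ℓn n ∈ L ∧ (n : ℝ)⁻¹ • ℓ ∈ K}, an n ℓ := by
      have h2 := finsum_mem_setOf_sub_mem_lattice hb (ℓn n)
        (fun ℓ => (n : ℝ)⁻¹ • ℓ ∈ K) (an n)
      rw [← hLdef] at h2
      rw [h2, ← smul_eq_mul, smul_finsum]
      rfl
    rw [hsum, hc₀]
    have key : ∀ s : ℝ, ((n : ℝ) ^ ((r : ℝ) / 2))⁻¹ * ((bn n * Real.exp (n * φ x₀))⁻¹ * s) /
        (ψ x₀ * ((2 * Real.pi) ^ ((r : ℝ) / 2) / (√Gram.det * √detH))) =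
        s / ((2 * Real.pi) ^ ((r : ℝ) / 2) * ψ x₀ / (√Gram.det * √detH) * bn n *
          (n : ℝ) ^ ((r : ℝ) / 2) * Real.exp (n * φ x₀)) := by
      intro s
      field_simp
    exact key _
  · intro n hn c hc
    have : pt n c ∉ {ℓ : Fin N → ℝ | (n : ℝ)⁻¹ • ℓ ∈ K} := by
      rw [Set.mem_ofPred_eq, hpt n hn]; exact hc
    simp only [F, Set.indicator_of_notMem this, mul_zero]
  · intro n hn c hc
    have hbpos := hbn n
    have h := hbig n hn (pt n c) (hptL n c) (by rw [hpt n hn]; exact hc)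
    rw [hpt n hn] at h
    rw [hF n hn c hc, abs_mul, abs_of_pos (by positivity), inv_mul_le_iff₀ (by positivity)]
    refine h.trans_eq ?_
    rw [show (n : ℝ) * φ (x₀ + B (u n c)) + n * ε n = n * φ x₀ +
      (n * (φ (x₀ + B (u n c)) - φ (x₀ + B 0)) + n * ε n) by simp; ring, Real.exp_add]
    ring
  · intro n hn c hc
    have hbpos := hbn n
    have h := hloc n hn (pt n c) (hptL n c) (by rw [hpt n hn]; exact hc)
    rw [hpt n hn] at h
    have hexp : Real.exp (n * φ (x₀ + B (u n c))) = Real.exp (n * φ x₀) *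
        Real.exp (n * (φ (x₀ + B (u n c)) - φ (x₀ + B 0))) := by
      rw [← Real.exp_add]
      congr 1
      simp
      ring
    have hsplit : F n c - ψ (x₀ + B (u n c)) *
        Real.exp (n * (φ (x₀ + B (u n c)) - φ (x₀ + B 0))) = (bn n * Real.exp (n * φ x₀))⁻¹ *
        (an n (pt n c) - bn n * ψ (x₀ + B (u n c)) * Real.exp (n * φ (x₀ + B (u n c)))) := by
      rw [hF n hn c (hK₁ hc), hexp]
      field_simp
    rw [hsplit, abs_mul, abs_of_pos (by positivity), inv_mul_le_iff₀ (by positivity)]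
    refine h.trans_eq ?_
    rw [hexp]
    ring
end

section
/- Let 0 ≤ m ≤ N and let x₁,…,x_m be linearly independent vectors in ℤ^N, where xᵢ = (x_{ij})_{j=1}^N. Let V ⊆ ℝ^N be the subspace spanned by x₁,…,x_m, and V^⊥ = {y ∈ ℝ^N : ⟨y,xᵢ⟩ = 0 for i = 1,…,m} its orthogonal complement. Let L = V ∩ ℤ^N, L^⊥ = V^⊥ ∩ ℤ^N, and let L₀ = {Σᵢ nᵢxᵢ : nᵢ ∈ ℤ} be the lattice spanned by x₁,…,x_m over ℤ. Then L^⊥ has rank N − m, and Vol(L^⊥) = Vol(L) = Vol(L₀)/q, where q is the order of the finite group L/L₀; explicitly, q equals the number of solutions (t₁,…,t_m) ∈ (ℝ/ℤ)^m of the system Σᵢ x_{ij} tᵢ ≡ 0 (mod 1) for j = 1,…,N. -/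
open Matrix Module

/-- A linearly independent family of integer vectors with saturated span is the upper part of an
invertible integer matrix. -/
theorem exists_unimodular_completion {N m : ℕ} (b : Fin m → Fin N → ℤ)
    (hb : LinearIndependent ℤ b)
    (hsat : ∀ (k : ℤ) (z : Fin N → ℤ), k ≠ 0 → k • z ∈ Submodule.span ℤ (Set.range b) →
      z ∈ Submodule.span ℤ (Set.range b)) :
    ∃ (B : Matrix (Fin m ⊕ Fin (N - m)) (Fin N) ℤ) (C : Matrix (Fin N) (Fin m ⊕ Fin (N - m)) ℤ),
      B * C = 1 ∧ C * B = 1 ∧ ∀ i, B (Sum.inl i) = b i := by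
  set W := Submodule.span ℤ (Set.range b)
  let bW : Basis (Fin m) ℤ W := Basis.span hb
  have : Module.IsTorsionFree ℤ ((Fin N → ℤ) ⧸ W) := by
    refine .of_smul_eq_zero fun k z hkz => ?_
    obtain ⟨z, rfl⟩ := W.mkQ_surjective z
    by_cases hk : k = 0
    · exact .inl hk
    · right
      rw [← map_smul, Submodule.mkQ_apply, Submodule.Quotient.mk_eq_zero] at hkz
      rw [Submodule.mkQ_apply, Submodule.Quotient.mk_eq_zero]
      exact hsat k z hk hkz
  have : Module.Free ℤ ((Fin N → ℤ) ⧸ W) := inferInstance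
  have hrank : finrank ℤ ((Fin N → ℤ) ⧸ W) = N - m := by
    have h := Submodule.finrank_quotient_add_finrank W
    rw [finrank_eq_card_basis bW] at h
    simp only [Fintype.card_fin, finrank_fin_fun] at h
    omega
  let e := Basis.sumQuot bW (finBasisOfFinrankEq ℤ _ hrank)
  refine ⟨((Pi.basisFun ℤ (Fin N)).toMatrix e)ᵀ, (e.toMatrix (Pi.basisFun ℤ (Fin N)))ᵀ, ?_, ?_, ?_⟩
  · rw [← transpose_mul, Basis.toMatrix_mul_toMatrix_flip, transpose_one]
  · rw [← transpose_mul, Basis.toMatrix_mul_toMatrix_flip, transpose_one]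
  · intro i
    ext j
    simp only [transpose_apply, Basis.toMatrix_apply, Pi.basisFun_repr, e, Basis.sumQuot_inl, bW]
    exact congrFun (congrArg Subtype.val (Basis.span_apply hb i)) j

/-- A case of Jacobi's complementary minor formula: complementary principal blocks of mutually
inverse matrices have proportional determinants. -/
theorem det_mul_det_toBlocks₂₂_of_mul_eq_one {R ι κ : Type*} [CommRing R] [Fintype ι]
    [Fintype κ] [DecidableEq ι] [DecidableEq κ] {G H : Matrix (ι ⊕ κ) (ι ⊕ κ) R}
    (h : G * H = 1) : G.det * H.toBlocks₂₂.det = G.toBlocks₁₁.det := by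
  have h1 : G * fromBlocks 1 H.toBlocks₁₂ 0 H.toBlocks₂₂ =
      fromBlocks G.toBlocks₁₁ 0 G.toBlocks₂₁ 1 := by
    rw [← fromBlocks_toBlocks G, ← fromBlocks_toBlocks H, fromBlocks_multiply,
      ← fromBlocks_one, fromBlocks_inj] at h
    conv_lhs => rw [← fromBlocks_toBlocks G]
    simp only [fromBlocks_multiply, h.2.1, h.2.2.2]
    simp
  have h2 := congrArg det h1
  rwa [det_mul, det_fromBlocks_zero₂₁, det_fromBlocks_zero₁₂, det_one, det_one, one_mul,
    mul_one] at h2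

theorem det_mul_transpose_self_nonneg {ι n : Type*} [Fintype ι] [Fintype n] [DecidableEq ι]
    (B : Matrix ι n ℤ) : 0 ≤ (B * Bᵀ).det := by
  have h := (posSemidef_self_mul_conjTranspose (B.map (Int.cast : ℤ → ℝ))).det_nonneg
  have h2 : (B.map (Int.cast : ℤ → ℝ)) * (B.map (Int.cast : ℤ → ℝ))ᴴ =
      (B * Bᵀ).map (Int.cast : ℤ → ℝ) := by
    ext i j
    simp [Matrix.mul_apply]
  rw [h2, ← Int.cast_det] at h
  exact_mod_cast h

/-- Complementary parts of a unimodular matrix and its inverse have equal Gram determinants. -/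
theorem det_gram_eq_of_mul_eq_one {ι κ n : Type*} [Fintype ι] [Fintype κ] [Fintype n]
    [DecidableEq ι] [DecidableEq κ] [DecidableEq n] (B : Matrix (ι ⊕ κ) n ℤ)
    (C : Matrix n (ι ⊕ κ) ℤ) (hBC : B * C = 1) (hCB : C * B = 1) :
    (Cᵀ * C).toBlocks₂₂.det = (B * Bᵀ).toBlocks₁₁.det := by
  have hGH : (B * Bᵀ) * (Cᵀ * C) = 1 := by
    rw [Matrix.mul_assoc, ← Matrix.mul_assoc Bᵀ, ← transpose_mul, hCB, transpose_one,
      Matrix.one_mul, hBC]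
  have hunit : (B * Bᵀ).det = 1 := by
    refine (Int.eq_one_or_neg_one_of_mul_eq_one (v := (Cᵀ * C).det) ?_).resolve_right ?_
    · rw [← det_mul, hGH, det_one]
    · have := det_mul_transpose_self_nonneg B
      omega
  simpa [hunit] using det_mul_det_toBlocks₂₂_of_mul_eq_one hGH

theorem AddCircle.coe_one_eq_zero_iff (s : ℝ) :
    ((s : ℝ) : AddCircle (1 : ℝ)) = 0 ↔ ∃ k : ℤ, s = k := by
  rw [AddCircle.coe_eq_zero_iff]
  simp [eq_comm]

/-- A nonsingular integer matrix `A` has `|det A|` torsion points of the torus in the kernel of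
its transpose. -/
theorem natCard_torus_ker {ι : Type*} [Fintype ι] [DecidableEq ι] (A : Matrix ι ι ℤ)
    (hA : A.det ≠ 0) :
    Nat.card {t : ι → AddCircle (1 : ℝ) | ∀ k, ∑ i, A i k • t i = 0} = A.det.natAbs := by
  set M : Matrix ι ι ℝ := Aᵀ.map (Int.cast : ℤ → ℝ) with hM
  have hMdet : IsUnit M.det := by
    rw [hM, ← Int.cast_det, det_transpose]
    exact (Int.cast_ne_zero.mpr hA).isUnit
  have hcast (z : ι → ℤ) : M *ᵥ (fun i => (z i : ℝ)) = fun i => (((Aᵀ *ᵥ z) i : ℤ) : ℝ) := by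
    ext i
    simp [M, mulVec, dotProduct]
  have hsum (s : ι → ℝ) (k : ι) :
      ∑ i, A i k • ((s i : ℝ) : AddCircle (1 : ℝ)) = (((M *ᵥ s) k : ℝ) : AddCircle (1 : ℝ)) := by
    simp only [M, mulVec, dotProduct, map_apply, transpose_apply]
    rw [show ((∑ i, (A i k : ℝ) * s i : ℝ) : AddCircle (1 : ℝ)) =
      QuotientAddGroup.mk' _ (∑ i, (A i k : ℝ) * s i) from rfl, map_sum]
    refine Finset.sum_congr rfl fun i _ => ?_
    rw [← zsmul_eq_mul, map_zsmul]
    rfl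
  let f : (ι → ℤ) →+ (ι → AddCircle (1 : ℝ)) :=
    { toFun := fun n i => (((M⁻¹ *ᵥ (fun j => (n j : ℝ))) i : ℝ) : AddCircle (1 : ℝ))
      map_zero' := by
        ext i
        simp [mulVec, dotProduct]
      map_add' := by
        intro a b
        ext i
        simp [mulVec, dotProduct, mul_add, Finset.sum_add_distrib] }
  have hf (n : ι → ℤ) (i : ι) :
      f n i = (((M⁻¹ *ᵥ (fun j => (n j : ℝ))) i : ℝ) : AddCircle (1 : ℝ)) := rfl
  have hrange : {t : ι → AddCircle (1 : ℝ) | ∀ k, ∑ i, A i k • t i = 0} = f.range := by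
    ext t
    simp only [Set.mem_ofPred_eq, SetLike.mem_coe, AddMonoidHom.mem_range]
    constructor
    · intro ht
      choose s hs using fun i => QuotientAddGroup.mk_surjective (t i)
      obtain rfl : (fun i => ((s i : ℝ) : AddCircle (1 : ℝ))) = t := funext hs
      simp only [hsum, AddCircle.coe_one_eq_zero_iff] at ht
      choose n hn using ht
      refine ⟨n, funext fun i => ?_⟩
      rw [hf, show (fun j => (n j : ℝ)) = M *ᵥ s from (funext hn).symm, mulVec_mulVec,
        nonsing_inv_mul _ hMdet, one_mulVec]
    · rintro ⟨n, rfl⟩ k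
      simp only [hf]
      rw [hsum, mulVec_mulVec, mul_nonsing_inv _ hMdet, one_mulVec,
        AddCircle.coe_one_eq_zero_iff]
      exact ⟨n k, rfl⟩
  have hker : f.ker = (LinearMap.range Aᵀ.mulVecLin).toAddSubgroup := by
    ext n
    simp only [AddMonoidHom.mem_ker, Submodule.mem_toAddSubgroup, LinearMap.mem_range,
      mulVecLin_apply]
    constructor
    · intro h
      have h' : ∀ i, ∃ k : ℤ, (M⁻¹ *ᵥ (fun j => (n j : ℝ))) i = k := fun i =>
        (AddCircle.coe_one_eq_zero_iff _).1 (congrFun h i)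
      choose z hz using h'
      refine ⟨z, funext fun i => ?_⟩
      have h2 := hcast z
      rw [← funext hz, mulVec_mulVec, mul_nonsing_inv _ hMdet, one_mulVec] at h2
      exact_mod_cast (congrFun h2 i).symm
    · rintro ⟨z, rfl⟩
      ext i
      rw [hf, ← hcast, mulVec_mulVec, nonsing_inv_mul _ hMdet, one_mulVec]
      exact (AddCircle.coe_one_eq_zero_iff _).2 ⟨z i, rfl⟩
  have hinj : Function.Injective Aᵀ.mulVecLin := by
    rw [← LinearMap.ker_eq_bot, LinearMap.ker_eq_bot']
    intro v hv
    exact eq_zero_of_mulVec_eq_zero (by rwa [det_transpose]) hv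
  have hcard := Submodule.natAbs_det_equiv (LinearMap.range Aᵀ.mulVecLin)
    (LinearEquiv.ofInjective Aᵀ.mulVecLin hinj)
  rw [hrange]
  calc Nat.card f.range = Nat.card ((ι → ℤ) ⧸ f.ker) :=
        (Nat.card_congr (QuotientAddGroup.quotientKerEquivRange f).toEquiv).symm
    _ = Nat.card ((ι → ℤ) ⧸ LinearMap.range Aᵀ.mulVecLin) := by rw [hker]; rfl
    _ = A.det.natAbs := by
        rw [← hcard, ← det_transpose A, ← LinearMap.det_toLin' Aᵀ]
        rfl


/-- Let `x₁,…,x_m ∈ ℤ^N` be linearly independent, spanning the subspace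
`V ⊆ ℝ^N`, with `V^⊥` its orthogonal complement; let `L = V ∩ ℤ^N`, `L^⊥ = V^⊥ ∩ ℤ^N`
and `L₀` the ℤ-span of `x₁,…,x_m`.  If `b` is a ℤ-basis of `L` (of some size `r`), then
`r = m`; `L^⊥` has rank `N − m` (it has a ℤ-basis `c` of `N − m` independent vectors) with
`Vol(L^⊥) = Vol(L)`; and `Vol(L) = Vol(L₀)/q`, where `q` is the number of solutions
`(t₁,…,t_m) ∈ (ℝ/ℤ)^m` of `∑ᵢ x_{ij} tᵢ ≡ 0 (mod 1)` for `j = 1,…,N` (which is the order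
of the finite group `L/L₀`).  Covolumes are square roots of Gram determinants of bases. -/
theorem stmt_3 (N m : ℕ) (hmN : m ≤ N) (x : Fin m → Fin N → ℤ)
    (hx : LinearIndependent ℝ (fun i => fun j => (x i j : ℝ)))
    (V : Submodule ℝ (Fin N → ℝ))
    (hV : V = Submodule.span ℝ (Set.range fun i => fun j => (x i j : ℝ)))
    (L Lp L0 : Set (Fin N → ℝ))
    (hL : L = {y | y ∈ V ∧ ∀ j, ∃ k : ℤ, y j = (k : ℝ)})
    (hLp : Lp = {y | (∀ i, ∑ j, y j * (x i j : ℝ)  = 0) ∧ ∀ j, ∃ k : ℤ, y j = (k : ℝ)})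
    (hL0 : L0 = {y | ∃ c : Fin m → ℤ, y = fun j => ∑ i, (c i : ℝ) * (x i j : ℝ)})
    (q : ℕ)
    (hq : q = Nat.card {t : Fin m → AddCircle (1:ℝ) |
        ∀ j : Fin N, ∑ i, (x i j) • t i = 0})
    (r : ℕ) (b : Fin r → (Fin N → ℝ))
    (hb_ind : LinearIndependent ℝ b)
    (hb_span : ∀ y, y ∈ L ↔ ∃ c : Fin r → ℤ, y = ∑ i, (c i : ℝ) • b i) :
    r = m ∧
    (∃ c : Fin (N - m) → (Fin N → ℝ),
      LinearIndependent ℝ c ∧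
      (∀ y, y ∈ Lp ↔ ∃ a : Fin (N - m) → ℤ, y = ∑ i, (a i : ℝ) • c i) ∧
      Real.sqrt (Matrix.det (Matrix.of fun i j => ∑ t, c i t * c j t)) =
        Real.sqrt (Matrix.det (Matrix.of fun i j => ∑ t, b i t * b j t))) ∧
    Real.sqrt (Matrix.det (Matrix.of fun i j => ∑ t, b i t * b j t)) =
      Real.sqrt (Matrix.det (Matrix.of fun i j => ∑ t, ((x i t : ℝ) * (x j t : ℝ)))) / q := by
  have hbL (i : Fin r) : b i ∈ L := (hb_span _).2 ⟨Pi.single i 1, by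
    simp [Pi.single_apply, Finset.sum_ite_eq', ite_smul]⟩
  have hbV (i : Fin r) : b i ∈ V := by
    have := hbL i
    rw [hL] at this
    exact this.1
  have hbint (i : Fin r) (j : Fin N) : ∃ k : ℤ, b i j = k := by
    have := hbL i
    rw [hL] at this
    exact this.2 j
  choose β hβ using hbint
  obtain rfl : b = fun i j => (β i j : ℝ) := by
    ext i j
    exact hβ i j
  have hspan (z : Fin N → ℤ) (hz : (fun j => (z j : ℝ)) ∈ V) :
      ∃ c : Fin r → ℤ, z = ∑ i, c i • β i := by
    obtain ⟨c, hc⟩ := (hb_span (fun j => (z j : ℝ))).1 (by rw [hL]; exact ⟨hz, fun j => ⟨z j, rfl⟩⟩)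
    refine ⟨c, funext fun j => ?_⟩
    have := congrFun hc j
    simp only [Finset.sum_apply, Pi.smul_apply, smul_eq_mul] at this ⊢
    exact_mod_cast this
  have hxV (i : Fin m) : (fun j => (x i j : ℝ)) ∈ V := by
    rw [hV]
    exact Submodule.subset_span ⟨i, rfl⟩
  choose A hA using fun i => hspan (x i) (hxV i)
  have hrm : r = m := by
    have h1 : Submodule.span ℝ (Set.range fun i => fun j => (β i j : ℝ)) = V := by
      apply le_antisymm
      · rw [Submodule.span_le]
        rintro _ ⟨i, rfl⟩
        exact hbV i
      · rw [hV, Submodule.span_le]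
        rintro _ ⟨i, rfl⟩
        have : (fun j => (x i j : ℝ)) = ∑ k, (A i k : ℝ) • (fun j => (β k j : ℝ)) := by
          ext j
          simp [hA i]
        simp only [SetLike.mem_coe]
        rw [this]
        exact Submodule.sum_mem _ fun k _ => Submodule.smul_mem _ _ (Submodule.subset_span ⟨k, rfl⟩)
    have h2 := finrank_span_eq_card hb_ind
    have h3 := finrank_span_eq_card hx
    rw [h1] at h2
    rw [← hV, h2] at h3
    simpa using h3
  subst hrm
  have hβ_ind : LinearIndependent ℤ β := by
    rw [Fintype.linearIndependent_iff] at hb_ind ⊢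
    intro g hg i
    have := hb_ind (fun i => (g i : ℝ)) (by
      ext j
      have := congrFun hg j
      simp only [Finset.sum_apply, Pi.smul_apply, smul_eq_mul, Pi.zero_apply] at this ⊢
      exact_mod_cast this) i
    exact_mod_cast this
  have hsat : ∀ (k : ℤ) (z : Fin N → ℤ), k ≠ 0 → k • z ∈ Submodule.span ℤ (Set.range β) →
      z ∈ Submodule.span ℤ (Set.range β) := by
    intro k z hk hz
    obtain ⟨c, hc⟩ := (Submodule.mem_span_range_iff_exists_fun ℤ).1 hz
    have hzV : (fun j => (z j : ℝ)) ∈ V := by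
      have hk' : (k : ℝ) ≠ 0 := Int.cast_ne_zero.2 hk
      have hkz : (k : ℝ) • (fun j => (z j : ℝ)) = ∑ i, (c i : ℝ) • (fun j => (β i j : ℝ)) := by
        ext j
        have := congrFun hc j
        simp only [Finset.sum_apply, Pi.smul_apply, smul_eq_mul] at this ⊢
        exact_mod_cast this.symm
      rw [← Submodule.smul_mem_iff V hk', hkz]
      exact Submodule.sum_mem _ fun i _ => Submodule.smul_mem _ _ (hbV i)
    obtain ⟨d, hd⟩ := hspan z hzV
    exact (Submodule.mem_span_range_iff_exists_fun ℤ).2 ⟨d, hd.symm⟩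
  obtain ⟨B, C, hBC, hCB, hB⟩ := exists_unimodular_completion β hβ_ind hsat
  have hxA : Matrix.of x = Matrix.of A * Matrix.of β := by
    ext i j
    simp [Matrix.mul_apply, hA i]
  have hdetA : (Matrix.of A).det ≠ 0 := by
    intro h0
    obtain ⟨v, hv0, hv⟩ := exists_vecMul_eq_zero_iff.2 h0
    have hvx : v ᵥ* Matrix.of x = 0 := by
      rw [hxA, ← vecMul_vecMul, hv, zero_vecMul]
    apply hv0
    rw [Fintype.linearIndependent_iff] at hx
    ext i
    have := hx (fun i => (v i : ℝ)) (by
      ext j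
      have := congrFun hvx j
      simp only [vecMul, dotProduct, of_apply, Finset.sum_apply, Pi.smul_apply, smul_eq_mul,
        Pi.zero_apply] at this ⊢
      exact_mod_cast this) i
    exact_mod_cast this
  have hgramβ : Matrix.det (Matrix.of fun i j => ∑ t, (β i t : ℝ) * (β j t : ℝ)) =
      ((Matrix.of β * (Matrix.of β)ᵀ).det : ℝ) := by
    rw [Int.cast_det]
    congr 1
    ext i j
    simp [Matrix.mul_apply]
  have hgramx : Matrix.det (Matrix.of fun i j => ∑ t, (x i t : ℝ) * (x j t : ℝ)) =
      ((Matrix.of x * (Matrix.of x)ᵀ).det : ℝ) := by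
    rw [Int.cast_det]
    congr 1
    ext i j
    simp [Matrix.mul_apply]
  refine ⟨rfl, ⟨fun i j => (C j (Sum.inr i) : ℝ), ?_, ?_, ?_⟩, ?_⟩
  · rw [Fintype.linearIndependent_iff]
    intro g hg i
    have hval (k : Fin (N - r)) :
        ∑ j, (B (Sum.inr i) j : ℝ) * (C j (Sum.inr k) : ℝ) = if i = k then 1 else 0 := by
      have := congrFun (congrFun hBC (Sum.inr i)) (Sum.inr k)
      simp only [Matrix.mul_apply, one_apply, Sum.inr.injEq] at this
      exact_mod_cast this
    calc g i = ∑ k, g k * ∑ j, (B (Sum.inr i) j : ℝ) * (C j (Sum.inr k) : ℝ) := by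
          simp [hval]
      _ = ∑ j, (B (Sum.inr i) j : ℝ) * (∑ k, g k • fun j => (C j (Sum.inr k) : ℝ)) j := by
          simp only [Finset.mul_sum, Finset.sum_apply, Pi.smul_apply, smul_eq_mul]
          rw [Finset.sum_comm]
          exact Finset.sum_congr rfl fun _ _ => Finset.sum_congr rfl fun _ _ => by ring
      _ = 0 := by
          rw [hg]
          simp
  · intro y
    have horth (z : Fin N → ℤ) : (∀ i, ∑ j, (z j : ℝ) * (x i j : ℝ) = 0) ↔
        Matrix.of β *ᵥ z = 0 := by
      have h1 : (∀ i, ∑ j, (z j : ℝ) * (x i j : ℝ) = 0) ↔ Matrix.of x *ᵥ z = 0 := by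
        rw [funext_iff]
        refine forall_congr' fun i => ?_
        simp only [mulVec, dotProduct, of_apply, Pi.zero_apply, mul_comm (x i _)]
        exact_mod_cast Iff.rfl
      rw [h1, hxA, ← mulVec_mulVec]
      exact ⟨fun h => eq_zero_of_mulVec_eq_zero hdetA h, fun h => by rw [h, mulVec_zero]⟩
    rw [hLp]
    constructor
    · rintro ⟨hy, hyint⟩
      choose z hz using hyint
      obtain rfl : y = fun j => (z j : ℝ) := funext hz
      rw [horth] at hy
      refine ⟨fun k => (B *ᵥ z) (Sum.inr k), ?_⟩
      have hzC : z = C *ᵥ (B *ᵥ z) := by rw [mulVec_mulVec, hCB, one_mulVec]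
      have hinl (i : Fin r) : (B *ᵥ z) (Sum.inl i) = 0 := by
        have := congrFun hy i
        simp only [mulVec, hB] at this ⊢
        exact this
      ext j
      have hj := congrFun hzC j
      rw [mulVec, dotProduct, Fintype.sum_sum_type] at hj
      simp only [hinl, mul_zero, Finset.sum_const_zero, zero_add] at hj
      simp only [Finset.sum_apply, Pi.smul_apply, smul_eq_mul]
      rw [hj]
      push_cast
      exact Finset.sum_congr rfl fun _ _ => mul_comm _ _
    · rintro ⟨a, rfl⟩
      have hcomb : (∑ i, (a i : ℝ) • fun j => (C j (Sum.inr i) : ℝ)) =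
          fun j => (((C *ᵥ Sum.elim 0 a) j : ℤ) : ℝ) := by
        ext j
        simp [mulVec, dotProduct, mul_comm]
      rw [hcomb]
      refine ⟨(horth _).2 ?_, fun j => ⟨_, rfl⟩⟩
      ext i
      have : (B *ᵥ (C *ᵥ Sum.elim 0 a)) (Sum.inl i) = 0 := by
        rw [mulVec_mulVec, hBC, one_mulVec]
        rfl
      simp only [mulVec, hB] at this ⊢
      exact this
  · rw [hgramβ]
    have h := det_gram_eq_of_mul_eq_one B C hBC hCB
    have hβB : (B * Bᵀ).toBlocks₁₁ = Matrix.of β * (Matrix.of β)ᵀ := by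
      ext i j
      simp [toBlocks₁₁, Matrix.mul_apply, hB]
    rw [← hβB, ← h, Int.cast_det]
    congr 2
    ext i j
    simp [toBlocks₂₂, Matrix.mul_apply]
  · have hq' : q = (Matrix.of A).det.natAbs := by
      rw [hq, ← natCard_torus_ker _ hdetA]
      congr 2
      ext t
      have hxt (j : Fin N) : ∑ i, x i j • t i = ∑ k, β k j • ∑ i, A i k • t i := by
        simp only [Finset.smul_sum, hA, Finset.sum_apply, Pi.smul_apply, Finset.sum_smul,
          smul_smul, smul_eq_mul]
        rw [Finset.sum_comm]
        exact Finset.sum_congr rfl fun _ _ => Finset.sum_congr rfl fun _ _ => by rw [mul_comm]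
      simp only [Set.mem_ofPred_eq, of_apply]
      constructor
      · intro h k
        have hβC (l : Fin r) : ∑ j, C j (Sum.inl k) * β l j = if l = k then 1 else 0 := by
          have := congrFun (congrFun hBC (Sum.inl l)) (Sum.inl k)
          simp only [Matrix.mul_apply, one_apply, Sum.inl.injEq, hB] at this
          rw [← this]
          exact Finset.sum_congr rfl fun _ _ => mul_comm _ _
        calc ∑ i, A i k • t i = ∑ l, (∑ j, C j (Sum.inl k) * β l j) • ∑ i, A i l • t i := by
              simp [hβC]
          _ = ∑ j, C j (Sum.inl k) • ∑ i, x i j • t i := by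
              simp_rw [hxt, Finset.smul_sum (s := Finset.univ) (f := fun l => β l _ • _),
                Finset.sum_smul, mul_smul]
              exact Finset.sum_comm
          _ = 0 := by simp [h]
      · intro h j
        rw [hxt]
        simp [h]
    have hdet : (Matrix.of x * (Matrix.of x)ᵀ).det =
        (Matrix.of A).det ^ 2 * (Matrix.of β * (Matrix.of β)ᵀ).det := by
      rw [hxA, transpose_mul, Matrix.mul_assoc, ← Matrix.mul_assoc (Matrix.of β), det_mul,
        det_mul, det_transpose]
      ring
    have hq0 : (q : ℝ) ≠ 0 := by
      rw [hq']
      exact_mod_cast Int.natAbs_ne_zero.2 hdetA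
    rw [hgramβ, hgramx, hdet, eq_div_iff hq0, hq', Nat.cast_natAbs]
    push_cast
    rw [Real.sqrt_mul (sq_nonneg _), Real.sqrt_sq_eq_abs, mul_comm]
end

section
/- Let G be a finite connected non-bipartite simple graph with g vertices and h edges, with adjacency matrix A, incidence matrix Â (the g × h 0-1 matrix with Â_{v,e} = 1 iff v is an endpoint of e), and degree diagonal matrix D_G. Then the lattice L¹ = {ν ∈ ℤ^{E(G)} : Âν = 0} (equivalently, the integer vectors ν with Σ_{e ∋ v} ν_e = 0 for every vertex v) has rank h − g and determinant Vol(L¹) = (1/2)·det(A + D_G)^{1/2}. -/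
open scoped Matrix

namespace SimpleGraph

variable {V : Type*} [Fintype V] [DecidableEq V] (G : SimpleGraph V)

/-- The unoriented incidence matrix, with columns indexed by the edges of `G` only. -/
def edgeIncMatrix : Matrix V G.edgeSet ℤ :=
  Matrix.of fun v e => if v ∈ (e : Sym2 V) then 1 else 0

variable [DecidableRel G.Adj]

theorem edgeIncMatrix_mul_transpose :
    G.edgeIncMatrix * G.edgeIncMatrixᵀ =
      G.adjMatrix ℤ + Matrix.diagonal fun v => (G.degree v : ℤ) := by
  have key : G.edgeIncMatrix * G.edgeIncMatrixᵀ = G.incMatrix ℤ * (G.incMatrix ℤ)ᵀ := by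
    ext u v
    simp only [Matrix.mul_apply, Matrix.transpose_apply, edgeIncMatrix, Matrix.of_apply]
    rw [← Finset.sum_subset (Finset.subset_univ G.edgeFinset)
      fun e _ he => by
        rw [G.incMatrix_of_notMem_incidenceSet (a := u)
          fun hmem => he (mem_edgeFinset.2 hmem.1), zero_mul]]
    rw [Finset.sum_subtype G.edgeFinset (p := fun e => e ∈ G.edgeSet)
      (fun e => mem_edgeFinset)]
    refine Finset.sum_congr rfl fun e _ => ?_
    simp [incMatrix_apply', incidenceSet, e.2]
  rw [key, incMatrix_mul_transpose]
  ext u v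
  by_cases huv : u = v
  · subst huv; simp
  · simp [huv, adjMatrix_apply]

theorem edgeIncMatrix_mulVec_single {u v : V} (huv : G.Adj u v) :
    G.edgeIncMatrix *ᵥ Pi.single ⟨s(u, v), huv⟩ 1 = Pi.single u 1 + Pi.single v 1 := by
  ext a
  have := huv.ne
  rw [Matrix.mulVec_single_one]
  by_cases h₁ : a = u <;> by_cases h₂ : a = v <;>
    simp_all [edgeIncMatrix, Matrix.col]

theorem sum_edgeIncMatrix (e : G.edgeSet) : ∑ v, G.edgeIncMatrix v e = 2 := by
  obtain ⟨e, he⟩ := e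
  induction e with
  | _ u v =>
    have huv : G.Adj u v := he
    have h := congrArg (fun x => ∑ a, x a) (G.edgeIncMatrix_mulVec_single huv)
    simpa [Matrix.mulVec_single_one, Finset.sum_add_distrib] using h

theorem sum_edgeIncMatrix_mulVec (x : G.edgeSet → ℤ) :
    ∑ v, (G.edgeIncMatrix *ᵥ x) v = 2 * ∑ e, x e := by
  simp only [Matrix.mulVec, dotProduct]
  rw [Finset.sum_comm]
  simp_rw [← Finset.sum_mul, sum_edgeIncMatrix, Finset.mul_sum]

variable {G}

/-- In a connected non-bipartite graph, every `e_v + e_w` is an integral combination of the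
columns of the incidence matrix. -/
theorem Connected.exists_edgeIncMatrix_mulVec (hconn : G.Connected) (hnb : ¬ G.Colorable 2)
    (v w : V) :
    ∃ x : G.edgeSet → ℤ, G.edgeIncMatrix *ᵥ x = Pi.single v 1 + Pi.single w 1 := by
  let H : Submodule ℤ (V → ℤ) := LinearMap.range G.edgeIncMatrix.mulVecLin
  let s (a : V) : V → ℤ := Pi.single a 1
  suffices h : s v + s w ∈ H by
    obtain ⟨x, hx⟩ := h
    exact ⟨x, hx⟩
  have hadj {a b : V} (hab : G.Adj a b) : s a + s b ∈ H :=
    ⟨_, G.edgeIncMatrix_mulVec_single hab⟩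
  have hor (a : V) : s a - s w ∈ H ∨ s a + s w ∈ H := by
    obtain ⟨p⟩ := hconn.preconnected a w
    induction p with
    | nil => left; simp
    | cons hab _ ih =>
      rcases ih with ih | ih
      · right
        have := H.sub_mem (hadj hab) ih
        rwa [show ∀ x y z : V → ℤ, x + y - (y - z) = x + z by intros; abel] at this
      · left
        have := H.sub_mem (hadj hab) ih
        rwa [show ∀ x y z : V → ℤ, x + y - (y + z) = x - z by intros; abel] at this
  have hw : s w + s w ∈ H := by
    by_contra hw
    classical
    have hcol : ∀ {a b : V}, G.Adj a b → decide (s a - s w ∈ H) ≠ decide (s b - s w ∈ H) := by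
      intro a b hab heq
      apply hw
      simp only [decide_eq_decide] at heq
      by_cases ha : s a - s w ∈ H
      · have := H.sub_mem (H.sub_mem (hadj hab) ha) (heq.1 ha)
        rwa [show ∀ x y z : V → ℤ, x + y - (x - z) - (y - z) = z + z by intros; abel] at this
      · have := H.sub_mem (H.add_mem ((hor a).resolve_left ha)
          ((hor b).resolve_left fun hb => ha (heq.2 hb))) (hadj hab)
        rwa [show ∀ x y z : V → ℤ, x + z + (y + z) - (x + y) = z + z by intros; abel] at this
    exact hnb (by simpa using (Coloring.mk (fun a => decide (s a - s w ∈ H)) hcol).colorable)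
  rcases hor v with h | h
  · have := H.add_mem h hw
    rwa [show ∀ x z : V → ℤ, x - z + (z + z) = x + z by intros; abel] at this
  · exact h

end SimpleGraph

theorem Matrix.det_mul_transpose_self_ne_zero {m n : Type*} [Fintype m] [DecidableEq m]
    [Fintype n] {b : Matrix m n ℤ} (hb : LinearIndependent ℤ b) : (b * bᵀ).det ≠ 0 := by
  intro h0
  obtain ⟨x, hx, hx0⟩ := Matrix.exists_vecMul_eq_zero_iff.2 h0
  have h1 : (x ᵥ* b) ⬝ᵥ (x ᵥ* b) = 0 := by
    rw [← Matrix.vecMul_vecMul] at hx0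
    have := congrArg (· ⬝ᵥ x) hx0
    simpa [Matrix.vecMul_transpose, ← Matrix.dotProduct_mulVec, dotProduct_comm,
      Matrix.dotProduct_mulVec] using this
  rw [dotProduct_self_eq_zero] at h1
  apply hx
  exact Matrix.vecMul_injective_iff.2 hb (by simpa using h1)

theorem Matrix.linearIndependent_of_det_mul_transpose_ne_zero {m n K : Type*} [Fintype m]
    [DecidableEq m] [Fintype n] [Field K] {b : Matrix m n K} (hb : (b * bᵀ).det ≠ 0) :
    LinearIndependent K b := by
  refine Matrix.vecMul_injective_iff.1 ((injective_iff_map_eq_zero b.vecMulLinear).2 fun x hx => ?_)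
  exact Matrix.eq_zero_of_vecMul_eq_zero hb
    (by rw [← Matrix.vecMul_vecMul, show x ᵥ* b = 0 from hx, Matrix.zero_vecMul])

open Matrix in
/-- A `ℤ`-basis of the integral kernel of the incidence matrix has `h - g` elements, and its Gram
determinant is a quarter of that of the incidence matrix. -/
theorem SimpleGraph.Connected.card_and_det_of_basis_ker {V ι : Type*} [Fintype V] [DecidableEq V]
    [Fintype ι] [DecidableEq ι] {G : SimpleGraph V} [DecidableRel G.Adj]
    (hconn : G.Connected) (hnb : ¬ G.Colorable 2) (b : Matrix ι G.edgeSet ℤ)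
    (hli : LinearIndependent ℤ b)
    (hb : ∀ x : G.edgeSet → ℤ, G.edgeIncMatrix *ᵥ x = 0 ↔ ∃ c : ι → ℤ, x = c ᵥ* b) :
    Fintype.card ι + Fintype.card V = Fintype.card G.edgeSet ∧
      4 * (b * bᵀ).det = (G.adjMatrix ℤ + diagonal fun v => (G.degree v : ℤ)).det := by
  rw [← G.edgeIncMatrix_mul_transpose]
  set B := G.edgeIncMatrix
  obtain ⟨w⟩ := hconn.nonempty
  choose C hC using fun v => hconn.exists_edgeIncMatrix_mulVec hnb v w
  let D : Matrix V V ℤ := of fun v a => (Pi.single v 1 + Pi.single w 1 : V → ℤ) a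
  have hCB : of C * Bᵀ = D := by
    ext v a
    have := congrFun (hC v) a
    rw [mulVec, dotProduct_comm] at this
    exact this
  have hD : D.det = 2 := by
    have : D = 1 + replicateCol Unit (1 : V → ℤ) * replicateRow Unit (Pi.single w 1 : V → ℤ) := by
      ext v a
      simp [D, Matrix.mul_apply, Matrix.one_apply, Pi.single_apply, eq_comm]
    rw [this, det_one_add_replicateCol_mul_replicateRow]
    simp
  have hbB : b * Bᵀ = 0 := by
    ext i a
    have := congrFun ((hb (b i)).2 ⟨Pi.single i 1, by simp [Matrix.row]⟩) a
    rw [mulVec, dotProduct_comm] at this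
    exact this
  let U : Matrix (ι ⊕ V) G.edgeSet ℤ := fromRows b (of C)
  have hUli : LinearIndependent ℤ U := by
    refine vecMul_injective_iff.1 ((injective_iff_map_eq_zero U.vecMulLinear).2 fun x hx => ?_)
    have h0 : (x ∘ Sum.inl) ᵥ* b + (x ∘ Sum.inr) ᵥ* of C = 0 := by
      rw [← vecMul_fromRows]; exact hx
    have h1 : (x ∘ Sum.inr) ᵥ* D = 0 := by
      have := congrArg (· ᵥ* Bᵀ) h0
      simpa [add_vecMul, vecMul_vecMul, hbB, hCB] using this
    have h2 : x ∘ Sum.inr = 0 := eq_zero_of_vecMul_eq_zero (by rw [hD]; norm_num) h1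
    rw [h2, zero_vecMul, add_zero] at h0
    have h3 : x ∘ Sum.inl = 0 := vecMul_injective_iff.2 hli (by simpa using h0)
    ext (i | v)
    · exact congrFun h3 i
    · exact congrFun h2 v
  have hUspan : ⊤ ≤ Submodule.span ℤ (Set.range U) := by
    intro x _
    obtain ⟨k, hk⟩ : ∃ k, ∑ v, (B *ᵥ x) v = 2 * k := ⟨_, G.sum_edgeIncMatrix_mulVec x⟩
    let a : V → ℤ := B *ᵥ x - Pi.single w k
    have ha : a ᵥ* D = B *ᵥ x := by
      have hs : ∑ v, a v = k := by
        simp only [a, Pi.sub_apply, Finset.sum_sub_distrib, hk]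
        simp; ring
      ext u
      have : (a ᵥ* D) u = a u + (∑ v, a v) * (Pi.single w 1 : V → ℤ) u := by
        simp [vecMul, dotProduct, D, mul_add, Finset.sum_add_distrib, Pi.single_apply]
      rw [this, hs]
      by_cases hu : u = w
      · subst hu; simp [a]
      · simp [a, hu]
    have hker : B *ᵥ (x - a ᵥ* of C) = 0 := by
      rw [mulVec_sub, ← vecMul_transpose B (a ᵥ* of C), vecMul_vecMul, hCB, ha, sub_self]
    obtain ⟨c, hc⟩ := (hb _).1 hker
    have hx : x = Sum.elim c a ᵥ* U := by
      rw [vecMul_fromRows]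
      simp [← hc]
    rw [hx, vecMul_eq_sum]
    exact Submodule.sum_mem _ fun i _ =>
      Submodule.smul_mem _ _ (Submodule.subset_span ⟨i, rfl⟩)
  let bU := Module.Basis.mk hUli hUspan
  have hcard : Fintype.card (ι ⊕ V) = Fintype.card G.edgeSet := by
    rw [← Module.finrank_eq_card_basis bU, Module.finrank_fintype_fun_eq_card]
  refine ⟨by simpa using hcard, ?_⟩
  let f : (ι ⊕ V) ≃ G.edgeSet := Fintype.equivOfCardEq hcard
  have hUdet : IsUnit (U.submatrix id f).det := by
    have := (Pi.basisFun ℤ G.edgeSet).isUnit_det (bU.reindex f)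
    rw [Module.Basis.det_apply, ← det_transpose, ← det_submatrix_equiv_self f] at this
    have hUf : U.submatrix id f =
        ((Pi.basisFun ℤ G.edgeSet).toMatrix (bU.reindex f))ᵀ.submatrix f f := by
      ext i j
      simp only [bU, Matrix.submatrix_apply, transpose_apply, Module.Basis.toMatrix_apply,
        Module.Basis.reindex_apply, Equiv.symm_apply_apply, Pi.basisFun_repr, id_eq]
      exact (congrFun (Module.Basis.mk_apply hUli hUspan i) (f j)).symm
    rwa [hUf]
  let S : Matrix (ι ⊕ V) G.edgeSet ℤ := fromRows b B
  have hmul (X Y : Matrix (ι ⊕ V) G.edgeSet ℤ) :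
      (X.submatrix id f).det * (Y.submatrix id f).det = (X * Yᵀ).det := by
    rw [← det_transpose (Y.submatrix id f), ← det_mul, transpose_submatrix,
      submatrix_mul_equiv, submatrix_id_id]
  have hBb : B * bᵀ = 0 := by
    rw [← transpose_transpose (B * bᵀ), transpose_mul, transpose_transpose, hbB, transpose_zero]
  have hSS : (S.submatrix id f).det * (S.submatrix id f).det = (b * bᵀ).det * (B * Bᵀ).det := by
    rw [hmul, transpose_fromRows, fromRows_mul_fromCols, hbB, hBb, det_fromBlocks_zero₂₁]
  have hUS : (U.submatrix id f).det * (S.submatrix id f).det = (b * bᵀ).det * 2 := by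
    rw [hmul, transpose_fromRows, fromRows_mul_fromCols, hbB, hCB, det_fromBlocks_zero₁₂, hD]
  have hUU := Int.isUnit_mul_self hUdet
  apply mul_left_cancel₀ (det_mul_transpose_self_ne_zero hli)
  linear_combination hSS + (S.submatrix id f).det ^ 2 * hUU -
    ((U.submatrix id f).det * (S.submatrix id f).det + (b * bᵀ).det * 2) * hUS

/-- An integral matrix with `ℤ`-independent rows has `ℝ`-independent rows. -/
theorem Matrix.linearIndependent_map_intCast {m n : Type*} [Fintype m] [DecidableEq m]
    [Fintype n] {b : Matrix m n ℤ} (hb : LinearIndependent ℤ b) :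
    LinearIndependent ℝ (b.map ((↑) : ℤ → ℝ)) := by
  apply Matrix.linearIndependent_of_det_mul_transpose_ne_zero
  have h : ((b * bᵀ).det : ℝ) = (b.map ((↑) : ℤ → ℝ) * (b.map ((↑) : ℤ → ℝ))ᵀ).det := by
    rw [← Matrix.transpose_map, Int.cast_det]
    congr 1
    ext i j
    simp [Matrix.mul_apply]
  rw [← h]
  exact_mod_cast Matrix.det_mul_transpose_self_ne_zero hb

open Classical in
/-- For a finite connected non-bipartite simple graph `G` with `g` vertices
and `h` edges, the lattice `L¹ = {ν ∈ ℤ^{E(G)} : ∑_{e∋v} ν_e = 0 for all v}` has rank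
`h − g` and determinant `Vol(L¹) = (1/2)·det(A + D_G)^{1/2}`: every ℤ-basis of `L¹`
has exactly `h − g` elements and Gram-determinant square root `(1/2)·det(A + D_G)^{1/2}`,
and such a ℤ-basis exists. -/
theorem stmt_6 {V : Type*} [Fintype V] [DecidableEq V] (G : SimpleGraph V)
    [DecidableRel G.Adj]
    (hconn : G.Connected) (hnb : ¬ G.Colorable 2)
    (g h : ℕ) (hg : Fintype.card V = g) (hh : Fintype.card G.edgeSet = h)
    (L : Set (G.edgeSet → ℝ))
    (hL : L = {ν | (∀ e, ∃ k : ℤ, ν e = (k : ℝ)) ∧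
        ∀ v : V, (∑ e : G.edgeSet, if v ∈ (e : Sym2 V) then ν e else 0) = 0}) :
    (∃ b : Fin (h - g) → (G.edgeSet → ℝ), LinearIndependent ℝ b ∧
        ∀ x, x ∈ L ↔ ∃ c : Fin (h - g) → ℤ, x = ∑ i, (c i : ℝ) • b i) ∧
    (∀ (m : ℕ) (b : Fin m → (G.edgeSet → ℝ)), LinearIndependent ℝ b →
        (∀ x, x ∈ L ↔ ∃ c : Fin m → ℤ, x = ∑ i, (c i : ℝ) • b i) →
        m = h - g ∧
        Real.sqrt (Matrix.det (Matrix.of fun i j => ∑ e : G.edgeSet, b i e * b j e)) =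
          (1/2) * Real.sqrt (Matrix.det
            (G.adjMatrix ℝ + Matrix.diagonal fun v => (G.degree v : ℝ)))) := by
  have hmem (y : G.edgeSet → ℤ) : (fun e => (y e : ℝ)) ∈ L ↔ G.edgeIncMatrix *ᵥ y = 0 := by
    have hsum (v : V) : (∑ e : G.edgeSet, if v ∈ (e : Sym2 V) then (y e : ℝ) else 0) =
        ((G.edgeIncMatrix *ᵥ y) v : ℝ) := by
      simp [Matrix.mulVec, dotProduct, SimpleGraph.edgeIncMatrix]
    rw [hL, funext_iff]
    simp only [Set.mem_ofPred_eq, hsum, Int.cast_eq_zero, Pi.zero_apply]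
    exact ⟨fun hy => hy.2, fun hy => ⟨fun e => ⟨y e, rfl⟩, hy⟩⟩
  have hlift {x : G.edgeSet → ℝ} (hx : x ∈ L) :
      ∃ y : G.edgeSet → ℤ, x = fun e => (y e : ℝ) := by
    rw [hL] at hx
    choose y hy using hx.1
    exact ⟨y, funext hy⟩
  have hcast {m : ℕ} (b : Matrix (Fin m) G.edgeSet ℤ) (c : Fin m → ℤ) :
      ∑ i, (c i : ℝ) • (fun e => (b i e : ℝ)) = fun e => ((c ᵥ* b) e : ℝ) := by
    ext e
    simp [Matrix.vecMul, dotProduct]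
  have hinj {y z : G.edgeSet → ℤ} : ((fun e => (y e : ℝ)) = fun e => (z e : ℝ)) ↔ y = z := by
    simp [funext_iff]
  constructor
  · let K : Submodule ℤ (G.edgeSet → ℤ) := LinearMap.ker G.edgeIncMatrix.mulVecLin
    obtain ⟨m, bK⟩ := Submodule.basisOfPid (Pi.basisFun ℤ G.edgeSet) K
    let b : Matrix (Fin m) G.edgeSet ℤ := Matrix.of fun i => (bK i : G.edgeSet → ℤ)
    have hli : LinearIndependent ℤ b := bK.linearIndependent.map' K.subtype K.ker_subtype
    have hb (x : G.edgeSet → ℤ) : G.edgeIncMatrix *ᵥ x = 0 ↔ ∃ c : Fin m → ℤ, x = c ᵥ* b := by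
      simp only [Matrix.vecMul_eq_sum]
      constructor
      · intro hx
        refine ⟨bK.repr ⟨x, hx⟩, ?_⟩
        have := congrArg K.subtype (bK.sum_repr ⟨x, hx⟩)
        rw [map_sum] at this
        exact this.symm
      · rintro ⟨c, rfl⟩
        exact K.sum_mem fun i _ => K.smul_mem _ (bK i).2
    have hm := (hconn.card_and_det_of_basis_ker hnb b hli hb).1
    rw [Fintype.card_fin] at hm
    obtain rfl : m = h - g := by omega
    refine ⟨b.map (↑), Matrix.linearIndependent_map_intCast hli, fun x => ⟨fun hx => ?_, ?_⟩⟩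
    · obtain ⟨y, rfl⟩ := hlift hx
      obtain ⟨c, rfl⟩ := (hb y).1 ((hmem y).1 hx)
      exact ⟨c, (hcast b c).symm⟩
    · rintro ⟨c, rfl⟩
      have := (hmem (c ᵥ* b)).2 ((hb _).2 ⟨c, rfl⟩)
      rwa [← hcast] at this
  · intro m b' hli' hb'
    have hbL (i : Fin m) : b' i ∈ L :=
      (hb' _).2 ⟨Pi.single i 1, by simp [Pi.single_apply]⟩
    obtain ⟨b, hbb⟩ : ∃ b : Matrix (Fin m) G.edgeSet ℤ, ∀ i, b' i = fun e => (b i e : ℝ) := by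
      choose b hbb using fun i => hlift (hbL i)
      exact ⟨b, hbb⟩
    obtain rfl : b' = fun i e => (b i e : ℝ) := funext hbb
    have hli : LinearIndependent ℤ b := by
      rw [Fintype.linearIndependent_iff] at hli'
      refine Fintype.linearIndependent_iff.2 fun c hc i => ?_
      have := hli' (fun i => (c i : ℝ)) (by
        rw [hcast b c, (Matrix.vecMul_eq_sum c b).trans hc]
        ext; simp) i
      exact_mod_cast this
    have hb (x : G.edgeSet → ℤ) : G.edgeIncMatrix *ᵥ x = 0 ↔ ∃ c : Fin m → ℤ, x = c ᵥ* b := by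
      rw [← hmem, hb']
      simp only [hcast, hinj]
    obtain ⟨hm, hdet⟩ := hconn.card_and_det_of_basis_ker hnb b hli hb
    rw [Fintype.card_fin] at hm
    refine ⟨by omega, ?_⟩
    have h₁ : Matrix.det (Matrix.of fun i j => ∑ e : G.edgeSet, (b i e : ℝ) * b j e) =
        ((b * bᵀ).det : ℤ) := by
      rw [Int.cast_det]
      congr 1
      ext i j
      simp [Matrix.mul_apply]
    have h₂ : Matrix.det (G.adjMatrix ℝ + Matrix.diagonal fun v => (G.degree v : ℝ)) =
        ((G.adjMatrix ℤ + Matrix.diagonal fun v => (G.degree v : ℤ)).det : ℤ) := by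
      rw [Int.cast_det]
      congr 1
      ext u v
      by_cases huv : u = v
      · subst huv; simp
      · simp [huv, SimpleGraph.adjMatrix_apply]
    rw [h₁, h₂, ← hdet]
    push_cast
    rw [Real.sqrt_mul (by norm_num), show (4 : ℝ) = 2 ^ 2 by norm_num,
      Real.sqrt_sq (by norm_num)]
    ring
end
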